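/- arXiv:1912.10936 — 2 statements merged into one kernel-verified Lean document; each statement's English description precedes it below -/
import Mathlib

section
/- A set E ⊂ ℝ^d of finite perimeter is indecomposable if and only if for every u ∈ BV_loc(ℝ^d) with V(u) < ∞ the following implication holds: if |Du|(E^1) = 0 then there exists a constant c ∈ ℝ such that u(x) = c for L^d-a.e. x ∈ E. -/
open MeasureTheory Filter
open scoped ENNReal NNReal

noncomputable section

abbrev Ed (d : ℕ) : Type := EuclideanSpace ℝ (Fin d)

/-- Divergence of a vector field on `ℝ^d`. -/
def vdiv {d : ℕ} (φ : Ed d → Ed d) (x : Ed d) : ℝ :=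
  ∑ i, fderiv ℝ φ x (EuclideanSpace.single i 1) i

/-- The variation `V(u, Ω)` of a locally integrable function on an (open) set `Ω`. -/
def variationOn {d : ℕ} (u : Ed d → ℝ) (Ω : Set (Ed d)) : ℝ≥0∞ :=
  ⨆ φ : {φ : Ed d → Ed d // ContDiff ℝ (⊤ : ℕ∞) φ ∧ HasCompactSupport φ ∧
      tsupport φ ⊆ Ω ∧ ∀ x, ‖φ x‖ ≤ 1},
    ENNReal.ofReal (∫ x in Ω, u x * vdiv φ.1 x)

/-- The total variation `V(u) = V(u, ℝ^d)`. -/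
def variation {d : ℕ} (u : Ed d → ℝ) : ℝ≥0∞ := variationOn u Set.univ

/-- The perimeter of a set `E ⊆ ℝ^d`. -/
def perimeter {d : ℕ} (E : Set (Ed d)) : ℝ≥0∞ :=
  variation (E.indicator fun _ => (1 : ℝ))

/-- A set of finite perimeter is decomposable if it splits into two disjoint pieces of positive
measure whose perimeters add up to the perimeter of the set. -/
def Decomposable {d : ℕ} (E : Set (Ed d)) : Prop :=
  ∃ A B : Set (Ed d), MeasurableSet A ∧ MeasurableSet B ∧ E = A ∪ B ∧ A ∩ B = ∅ ∧
    0 < volume A ∧ 0 < volume B ∧ perimeter E = perimeter A + perimeter B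

def Indecomposable {d : ℕ} (E : Set (Ed d)) : Prop := ¬ Decomposable E

/-- `x` is a point of density `t` for `E`. -/
def densityPt {d : ℕ} (E : Set (Ed d)) (t : ℝ≥0∞) (x : Ed d) : Prop :=
  Tendsto (fun r : ℝ => volume (E ∩ Metric.ball x r) / volume (Metric.ball x r))
    (nhdsWithin 0 (Set.Ioi 0)) (nhds t)

/-- The set `E^t` of points of density `t` of `E`. -/
def densitySet {d : ℕ} (E : Set (Ed d)) (t : ℝ≥0∞) : Set (Ed d) := {x | densityPt E t x}

/-- The variation measure `|Du|` evaluated on an arbitrary set, obtained from the variation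
on open sets by the (outer regular) Carathéodory construction. -/
def varMeasure {d : ℕ} (u : Ed d → ℝ) (B : Set (Ed d)) : ℝ≥0∞ :=
  ⨅ (Ω : Set (Ed d)) (_ : IsOpen Ω) (_ : B ⊆ Ω), variationOn u Ω

open Set Metric
open scoped Topology ContDiff Convolution

/-- A smooth compactly supported vector field. -/
structure IsTest {d : ℕ} (φ : Ed d → Ed d) : Prop where
  contDiff : ContDiff ℝ (⊤ : ℕ∞) φ
  hasCompactSupport : HasCompactSupport φ

/-- The distributional pairing `∫ u div φ`. -/
def pairing {d : ℕ} (u : Ed d → ℝ) (φ : Ed d → Ed d) : ℝ := ∫ x, u x * vdiv φ x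

section Basic

variable {d : ℕ} {u : Ed d → ℝ} {φ ψ : Ed d → Ed d} {Ω : Set (Ed d)}

theorem IsTest.continuous (h : IsTest φ) : Continuous φ := h.contDiff.continuous

theorem IsTest.differentiable (h : IsTest φ) : Differentiable ℝ φ :=
  h.contDiff.differentiable (by simp)

theorem IsTest.add (h : IsTest φ) (h' : IsTest ψ) : IsTest (fun x => φ x + ψ x) :=
  ⟨h.contDiff.add h'.contDiff, h.hasCompactSupport.add h'.hasCompactSupport⟩

theorem IsTest.smul {f : Ed d → ℝ} (h : IsTest φ) (hf : ContDiff ℝ (⊤ : ℕ∞) f) :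
    IsTest (fun x => f x • φ x) :=
  ⟨hf.smul h.contDiff, h.hasCompactSupport.mono fun x hx hx' => hx (by simp [hx'])⟩

theorem IsTest.smul_vec {f : Ed d → ℝ} (hf : ContDiff ℝ (⊤ : ℕ∞) f) (hc : HasCompactSupport f)
    (v : Ed d) : IsTest (fun x => f x • v) :=
  ⟨hf.smul contDiff_const, hc.smul_right (f' := fun _ => v)⟩

theorem IsTest.const_smul (h : IsTest φ) (c : ℝ) : IsTest (fun x => c • φ x) :=
  h.smul contDiff_const

theorem IsTest.sub (h : IsTest φ) (h' : IsTest ψ) : IsTest (fun x => φ x - ψ x) := by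
  simpa [sub_eq_add_neg] using h.add (h'.const_smul (-1))

theorem IsTest.comp_add_right (h : IsTest φ) (z : Ed d) : IsTest (fun x => φ (x + z)) :=
  ⟨h.contDiff.comp (contDiff_id.add contDiff_const),
    h.hasCompactSupport.comp_homeomorph (Homeomorph.addRight z)⟩

theorem IsTest.zero : IsTest (fun _ : Ed d => (0 : Ed d)) :=
  ⟨contDiff_const, HasCompactSupport.zero⟩

theorem IsTest.sum {ι : Type*} (s : Finset ι) {φ : ι → Ed d → Ed d} (h : ∀ i, IsTest (φ i)) :
    IsTest (fun x => ∑ i ∈ s, φ i x) := by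
  classical
  induction s using Finset.induction_on with
  | empty => simpa using IsTest.zero
  | insert i s hi ih => simpa [Finset.sum_insert hi] using (h i).add ih

theorem vdiv_add (h : IsTest φ) (h' : IsTest ψ) (x : Ed d) :
    vdiv (fun x => φ x + ψ x) x = vdiv φ x + vdiv ψ x := by
  unfold vdiv
  rw [← Finset.sum_add_distrib]
  refine Finset.sum_congr rfl fun i _ => ?_
  rw [fderiv_fun_add (h.differentiable x) (h'.differentiable x)]
  rfl

theorem sum_apply_single (L : Ed d →L[ℝ] ℝ) (v : Ed d) :
    ∑ i, L (EuclideanSpace.single i 1) * v i = L v := by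
  conv_rhs => rw [← (EuclideanSpace.basisFun (Fin d) ℝ).sum_repr v]
  simp [map_sum, mul_comm]

theorem vdiv_smul {f : Ed d → ℝ} {x : Ed d} (hf : DifferentiableAt ℝ f x)
    (h : DifferentiableAt ℝ φ x) :
    vdiv (fun x => f x • φ x) x = f x * vdiv φ x + fderiv ℝ f x (φ x) := by
  unfold vdiv
  rw [fderiv_fun_smul hf h, ← sum_apply_single, Finset.mul_sum, ← Finset.sum_add_distrib]
  refine Finset.sum_congr rfl fun i _ => ?_
  simp

theorem vdiv_smul_vec {f : Ed d → ℝ} {x : Ed d} (hf : DifferentiableAt ℝ f x) (v : Ed d) :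
    vdiv (fun x => f x • v) x = fderiv ℝ f x v := by
  rw [vdiv_smul hf (differentiableAt_const v)]
  simp [vdiv]

theorem vdiv_const_smul (h : IsTest φ) (c : ℝ) (x : Ed d) :
    vdiv (fun x => c • φ x) x = c * vdiv φ x := by
  rw [vdiv_smul (differentiableAt_const c) (h.differentiable x)]
  simp

theorem vdiv_comp_add_right (φ : Ed d → Ed d) (z x : Ed d) :
    vdiv (fun x => φ (x + z)) x = vdiv φ (x + z) := by
  unfold vdiv
  simp only [fderiv_comp_add_right]

theorem vdiv_eq_zero {x : Ed d} (hx : x ∉ tsupport φ) : vdiv φ x = 0 := by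
  unfold vdiv
  have : fderiv ℝ φ x = 0 := by
    by_contra hne
    exact hx (support_fderiv_subset ℝ hne)
  simp [this]

theorem IsTest.continuous_vdiv (h : IsTest φ) : Continuous (vdiv φ) := by
  unfold vdiv
  refine continuous_finsetSum _ fun i _ => ?_
  have h1 : Continuous fun x => fderiv ℝ φ x (EuclideanSpace.single i 1) :=
    (h.contDiff.continuous_fderiv (by simp)).clm_apply continuous_const
  exact (EuclideanSpace.proj i : Ed d →L[ℝ] ℝ).continuous.comp h1

theorem IsTest.hasCompactSupport_vdiv (h : IsTest φ) : HasCompactSupport (vdiv φ) :=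
  HasCompactSupport.intro h.hasCompactSupport fun _ hx => vdiv_eq_zero hx

theorem IsTest.integrable_mul (h : IsTest φ) (hu : LocallyIntegrable u) :
    Integrable fun x => u x * vdiv φ x := by
  have := hu.integrable_smul_left_of_hasCompactSupport h.continuous_vdiv h.hasCompactSupport_vdiv
  simpa [mul_comm] using this

theorem IsTest.integrable_vdiv (h : IsTest φ) : Integrable (vdiv φ) :=
  h.continuous_vdiv.integrable_of_hasCompactSupport h.hasCompactSupport_vdiv

theorem pairing_add (hu : LocallyIntegrable u) (h : IsTest φ) (h' : IsTest ψ) :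
    pairing u (fun x => φ x + ψ x) = pairing u φ + pairing u ψ := by
  unfold pairing
  rw [← integral_add (h.integrable_mul hu) (h'.integrable_mul hu)]
  simp only [vdiv_add h h', mul_add]

theorem pairing_const_smul (u : Ed d → ℝ) (h : IsTest φ) (c : ℝ) :
    pairing u (fun x => c • φ x) = c * pairing u φ := by
  unfold pairing
  rw [← integral_const_mul]
  simp only [vdiv_const_smul h, mul_left_comm]

theorem pairing_zero (u : Ed d → ℝ) : pairing u (fun _ => 0) = 0 := by
  simp [pairing, vdiv]

theorem pairing_sum (hu : LocallyIntegrable u) {ι : Type*} (s : Finset ι) {φ : ι → Ed d → Ed d}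
    (h : ∀ i, IsTest (φ i)) :
    pairing u (fun x => ∑ i ∈ s, φ i x) = ∑ i ∈ s, pairing u (φ i) := by
  classical
  induction s using Finset.induction_on with
  | empty => simpa using pairing_zero u
  | insert i s hi ih =>
    simp only [Finset.sum_insert hi]
    rw [pairing_add hu (h i) (IsTest.sum s h), ih]

theorem setIntegral_mul_vdiv (u : Ed d → ℝ) (hΩ : tsupport φ ⊆ Ω) :
    ∫ x in Ω, u x * vdiv φ x = pairing u φ :=
  setIntegral_eq_integral_of_forall_compl_eq_zero fun x hx => by
    rw [vdiv_eq_zero fun h => hx (hΩ h), mul_zero]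

theorem ofReal_pairing_le (u : Ed d → ℝ) (h : IsTest φ) (hΩ : tsupport φ ⊆ Ω)
    (h1 : ∀ x, ‖φ x‖ ≤ 1) : ENNReal.ofReal (pairing u φ) ≤ variationOn u Ω := by
  rw [← setIntegral_mul_vdiv u hΩ]
  exact le_iSup (fun φ : {φ : Ed d → Ed d // ContDiff ℝ (⊤ : ℕ∞) φ ∧ HasCompactSupport φ ∧
      tsupport φ ⊆ Ω ∧ ∀ x, ‖φ x‖ ≤ 1} => ENNReal.ofReal (∫ x in Ω, u x * vdiv φ.1 x))
    ⟨φ, h.contDiff, h.hasCompactSupport, hΩ, h1⟩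

theorem variationOn_le {M : ℝ≥0∞}
    (H : ∀ φ : Ed d → Ed d, IsTest φ → tsupport φ ⊆ Ω → (∀ x, ‖φ x‖ ≤ 1) →
      ENNReal.ofReal (pairing u φ) ≤ M) : variationOn u Ω ≤ M := by
  refine iSup_le fun φ => ?_
  obtain ⟨φ, h1, h2, h3, h4⟩ := φ
  rw [setIntegral_mul_vdiv u h3]
  exact H φ ⟨h1, h2⟩ h3 h4

theorem variationOn_mono {Ω' : Set (Ed d)} (h : Ω ⊆ Ω') : variationOn u Ω ≤ variationOn u Ω' :=
  variationOn_le fun _ hφ hs h1 => ofReal_pairing_le u hφ (hs.trans h) h1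

theorem variationOn_le_variation : variationOn u Ω ≤ variation u :=
  variationOn_mono (subset_univ _)

theorem variationOn_lt_top (h : variation u < ⊤) : variationOn u Ω < ⊤ :=
  variationOn_le_variation.trans_lt h

theorem pairing_congr_ae {v : Ed d → ℝ} (h : u =ᵐ[volume] v) (φ : Ed d → Ed d) :
    pairing u φ = pairing v φ :=
  integral_congr_ae (h.mono fun x hx => by simp only [hx])

theorem variationOn_congr_ae {v : Ed d → ℝ} (h : u =ᵐ[volume] v) :
    variationOn u Ω = variationOn v Ω :=
  le_antisymm
    (variationOn_le fun φ hφ hs h1 => pairing_congr_ae h φ ▸ ofReal_pairing_le v hφ hs h1)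
    (variationOn_le fun φ hφ hs h1 => pairing_congr_ae h φ ▸ ofReal_pairing_le u hφ hs h1)

theorem pairing_le_toReal (hV : variationOn u Ω < ⊤) (h : IsTest φ) (hΩ : tsupport φ ⊆ Ω)
    (h1 : ∀ x, ‖φ x‖ ≤ 1) : pairing u φ ≤ (variationOn u Ω).toReal := by
  rw [← ENNReal.ofReal_le_iff_le_toReal hV.ne]
  exact ofReal_pairing_le u h hΩ h1

theorem pairing_le_mul_toReal (hV : variationOn u Ω < ⊤) (h : IsTest φ) (hΩ : tsupport φ ⊆ Ω)
    {c : ℝ} (hc : 0 ≤ c) (h1 : ∀ x, ‖φ x‖ ≤ c) : pairing u φ ≤ c * (variationOn u Ω).toReal := by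
  rcases hc.eq_or_lt with rfl | hc
  · have : φ = fun _ => 0 := funext fun x => norm_le_zero_iff.1 (h1 x)
    rw [this, pairing_zero, zero_mul]
  · have h2 := pairing_le_toReal hV (h.const_smul c⁻¹)
      ((closure_mono (Function.support_const_smul_subset c⁻¹ φ)).trans hΩ) (fun x => by
        rw [norm_smul, norm_inv, Real.norm_of_nonneg hc.le, inv_mul_le_iff₀ hc, mul_one]
        exact h1 x)
    rwa [pairing_const_smul u h, inv_mul_le_iff₀ hc] at h2

theorem integral_vdiv (h : IsTest φ) : ∫ x, vdiv φ x = 0 := by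
  unfold vdiv
  have key : ∀ i : Fin d, Integrable (fun x => fderiv ℝ φ x (EuclideanSpace.single i 1) i) ∧
      ∫ x, fderiv ℝ φ x (EuclideanSpace.single i 1) i = 0 := by
    intro i
    have hsm : ContDiff ℝ (⊤ : ℕ∞) fun x => φ x i :=
      (EuclideanSpace.proj i : Ed d →L[ℝ] ℝ).contDiff.comp h.contDiff
    have hcs : HasCompactSupport fun x => φ x i :=
      h.hasCompactSupport.comp_left (g := fun v : Ed d => v i) rfl
    have heq : ∀ x, fderiv ℝ φ x (EuclideanSpace.single i 1) i =
        fderiv ℝ (fun x => φ x i) x (EuclideanSpace.single i 1) := by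
      intro x
      have := ((EuclideanSpace.proj i : Ed d →L[ℝ] ℝ).hasFDerivAt).comp x
        (h.differentiable x).hasFDerivAt
      have h2 : fderiv ℝ (fun x => φ x i) x = _ := this.fderiv
      rw [h2]
      rfl
    simp only [heq]
    have hint : Integrable fun x => fderiv ℝ (fun x => φ x i) x (EuclideanSpace.single i 1) := by
      refine Continuous.integrable_of_hasCompactSupport ?_ ?_
      · exact (hsm.continuous_fderiv (by simp)).clm_apply continuous_const
      · exact hcs.fderiv_apply ℝ _
    refine ⟨hint, ?_⟩
    have hint2 := hsm.continuous.integrable_of_hasCompactSupport hcs (μ := volume)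
    have := integral_mul_fderiv_eq_neg_fderiv_mul_of_integrable (μ := (volume : Measure (Ed d)))
      (f := fun _ => (1 : ℝ)) (g := fun x => φ x i) (v := EuclideanSpace.single i 1)
      (by simp) (by simpa using hint) (by simpa using hint2)
      (fun x _ => differentiableAt_const _) (fun x _ => hsm.differentiable (by simp) x)
    simpa using this
  rw [integral_finsetSum _ fun i _ => (key i).1]
  exact Finset.sum_eq_zero fun i _ => (key i).2

theorem tsupport_smul_fun_subset (f : Ed d → ℝ) (φ : Ed d → Ed d) :
    tsupport (fun x => f x • φ x) ⊆ tsupport φ :=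
  closure_mono (Function.support_smul_subset_right f φ)

/-- Integration by parts for smooth functions. -/
theorem pairing_smooth {f : Ed d → ℝ} (hf : ContDiff ℝ (⊤ : ℕ∞) f) (h : IsTest φ) :
    pairing f φ = - ∫ x, fderiv ℝ f x (φ x) := by
  have h1 := integral_vdiv (h.smul hf)
  have hd : Differentiable ℝ f := hf.differentiable (by simp)
  simp only [fun x => vdiv_smul (hd x) (h.differentiable x)] at h1
  rw [integral_add (h.integrable_mul hf.continuous.locallyIntegrable)] at h1
  · unfold pairing
    linarith
  · refine Continuous.integrable_of_hasCompactSupport ?_ ?_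
    · exact (hf.continuous_fderiv (by simp)).clm_apply h.continuous
    · refine h.hasCompactSupport.mono fun x hx hx' => hx ?_
      simp [hx']

/-- Chain rule in weak form for smooth functions. -/
theorem pairing_comp_smooth {f : Ed d → ℝ} {g : ℝ → ℝ} (hf : ContDiff ℝ (⊤ : ℕ∞) f)
    (hg : ContDiff ℝ (⊤ : ℕ∞) g) (h : IsTest φ) :
    pairing (fun x => g (f x)) φ = pairing f (fun x => deriv g (f x) • φ x) := by
  have hg' : ContDiff ℝ (⊤ : ℕ∞) (deriv g) := by
    have := contDiff_infty_iff_deriv.1 hg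
    exact this.2
  rw [pairing_smooth (f := fun x => g (f x)) (hg.comp hf) h,
    pairing_smooth hf (h.smul (f := fun x => deriv g (f x)) (hg'.comp hf))]
  congr 1
  refine integral_congr_ae (Eventually.of_forall fun x => ?_)
  have h1 := ((hg.differentiable (by simp) (f x)).hasDerivAt.comp_hasFDerivAt x
    (hf.differentiable (by simp) x).hasFDerivAt)
  have h2 : fderiv ℝ (fun x => g (f x)) x = _ := h1.fderiv
  simp only [h2, map_smul]
  rfl

end Basic

section VariationMeasure

theorem Metric.AreSeparated.separatedNhds {X : Type*} [EMetricSpace X] {s t : Set X}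
    (h : Metric.AreSeparated s t) : SeparatedNhds s t := by
  obtain ⟨r, hr, h⟩ := h
  have hr2 : 0 < r / 2 := ENNReal.half_pos hr
  refine ⟨⋃ x ∈ s, Metric.eball x (r / 2), ⋃ y ∈ t, Metric.eball y (r / 2),
    isOpen_biUnion fun _ _ => Metric.isOpen_eball, isOpen_biUnion fun _ _ => Metric.isOpen_eball,
    fun x hx => mem_biUnion hx (Metric.mem_eball_self hr2),
    fun x hx => mem_biUnion hx (Metric.mem_eball_self hr2), ?_⟩
  rw [Set.disjoint_left]
  intro z hz hz'
  simp only [mem_iUnion, Metric.mem_eball, exists_prop] at hz hz'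
  obtain ⟨x, hx, hxz⟩ := hz
  obtain ⟨y, hy, hyz⟩ := hz'
  refine (h x hx y hy).not_gt ?_
  calc edist x y ≤ edist z x + edist z y := edist_triangle_left x y z
    _ < r / 2 + r / 2 := ENNReal.add_lt_add hxz hyz
    _ = r := ENNReal.add_halves r

variable {d : ℕ} {u : Ed d → ℝ} {φ : Ed d → Ed d}

theorem pairing_le_sum (hu : LocallyIntegrable u) (hV : variation u < ⊤) (hφ : IsTest φ)
    {ι : Type*} [Fintype ι] {Ω : ι → Set (Ed d)} (hΩ : ∀ i, IsOpen (Ω i))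
    (hcov : tsupport φ ⊆ ⋃ i, Ω i) {c : ι → ℝ} (hc : ∀ i, 0 ≤ c i)
    (hb : ∀ i, ∀ x ∈ Ω i, ‖φ x‖ ≤ c i) :
    pairing u φ ≤ ∑ i, c i * (variationOn u (Ω i)).toReal := by
  obtain ⟨f, hf⟩ := SmoothPartitionOfUnity.exists_isSubordinate (modelWithCornersSelf ℝ (Ed d))
    (isClosed_tsupport φ) Ω hΩ hcov
  have hfs : ∀ i, ContDiff ℝ (⊤ : ℕ∞) (f i : Ed d → ℝ) := fun i => (f i).contMDiff.contDiff
  have hsum : (fun x => ∑ i, f i x • φ x) = φ := by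
    funext x
    rw [← Finset.sum_smul]
    by_cases hx : x ∈ tsupport φ
    · have := f.sum_eq_one hx
      rw [finsum_eq_sum_of_fintype] at this
      rw [this, one_smul]
    · rw [image_eq_zero_of_notMem_tsupport hx, smul_zero]
  have htest : ∀ i, IsTest fun x => f i x • φ x := fun i => hφ.smul (hfs i)
  calc pairing u φ = pairing u (fun x => ∑ i, f i x • φ x) := by rw [hsum]
    _ = ∑ i, pairing u (fun x => f i x • φ x) := pairing_sum hu Finset.univ htest
    _ ≤ ∑ i, c i * (variationOn u (Ω i)).toReal := by
      refine Finset.sum_le_sum fun i _ => ?_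
      have hts : tsupport (fun x => f i x • φ x) ⊆ tsupport (f i) :=
        closure_mono (Function.support_smul_subset_left (f i) φ)
      refine pairing_le_mul_toReal (variationOn_lt_top hV) (htest i) (hts.trans (hf i)) (hc i)
        fun x => ?_
      by_cases hx : x ∈ Ω i
      · rw [norm_smul, Real.norm_of_nonneg (f.nonneg i x)]
        calc f i x * ‖φ x‖ ≤ 1 * ‖φ x‖ := by
              gcongr
              exact f.le_one i x
          _ ≤ c i := by simpa using hb i x hx
      · rw [image_eq_zero_of_notMem_tsupport fun h => hx (hf i h), zero_smul, norm_zero]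
        exact hc i

theorem variationOn_empty (u : Ed d → ℝ) : variationOn u ∅ = 0 := by
  refine le_antisymm (variationOn_le fun φ hφ hs _ => ?_) bot_le
  have : φ = fun _ => 0 := funext fun x =>
    image_eq_zero_of_notMem_tsupport fun hx => (hs hx).elim
  rw [this, pairing_zero]
  simp

theorem variationOn_iUnion_le (hu : LocallyIntegrable u) (hV : variation u < ⊤)
    {Ω : ℕ → Set (Ed d)} (hΩ : ∀ i, IsOpen (Ω i)) :
    variationOn u (⋃ i, Ω i) ≤ ∑' i, variationOn u (Ω i) := by
  refine variationOn_le fun φ hφ hs h1 => ?_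
  obtain ⟨t, ht⟩ := hφ.hasCompactSupport.elim_finite_subcover Ω hΩ hs
  have := pairing_le_sum hu hV hφ (ι := t) (Ω := fun i => Ω i) (fun i => hΩ i)
    (by simpa [iUnion_subtype] using ht) (c := fun _ => 1) (fun _ => zero_le_one)
    (fun _ x _ => h1 x)
  simp only [one_mul] at this
  calc ENNReal.ofReal (pairing u φ)
      ≤ ENNReal.ofReal (∑ i : t, (variationOn u (Ω i)).toReal) := ENNReal.ofReal_le_ofReal this
    _ = ∑ i ∈ t, variationOn u (Ω i) := by
      rw [ENNReal.ofReal_sum_of_nonneg fun _ _ => ENNReal.toReal_nonneg]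
      simp_rw [ENNReal.ofReal_toReal (variationOn_lt_top hV).ne]
      exact Finset.sum_coe_sort t fun i => variationOn u (Ω i)
    _ ≤ ∑' i, variationOn u (Ω i) := ENNReal.sum_le_tsum t

theorem variationOn_add_le (hu : LocallyIntegrable u) {Ω Ω' : Set (Ed d)}
    (hd : Disjoint Ω Ω') : variationOn u Ω + variationOn u Ω' ≤ variationOn u (Ω ∪ Ω') := by
  conv_lhs => rw [variationOn, variationOn]
  have hne : ∀ Ω : Set (Ed d), Nonempty {φ : Ed d → Ed d // ContDiff ℝ (⊤ : ℕ∞) φ ∧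
      HasCompactSupport φ ∧ tsupport φ ⊆ Ω ∧ ∀ x, ‖φ x‖ ≤ 1} := fun Ω =>
    ⟨⟨fun _ => 0, contDiff_const, HasCompactSupport.zero, by simp [tsupport], by simp⟩⟩
  have := hne Ω
  have := hne Ω'
  refine ENNReal.iSup_add_iSup_le ?_
  rintro ⟨φ, h1, h2, h3, h4⟩ ⟨ψ, k1, k2, k3, k4⟩
  have hφ : IsTest φ := ⟨h1, h2⟩
  have hψ : IsTest ψ := ⟨k1, k2⟩
  simp only [setIntegral_mul_vdiv u h3, setIntegral_mul_vdiv u k3]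
  rcases le_total 0 (pairing u φ) with hp | hp
  · rcases le_total 0 (pairing u ψ) with hq | hq
    · rw [← ENNReal.ofReal_add hp hq, ← pairing_add hu hφ hψ]
      refine ofReal_pairing_le u (hφ.add hψ) ?_ fun x => ?_
      · refine (tsupport_add φ ψ).trans (union_subset_union h3 k3)
      · by_cases hx : x ∈ tsupport φ
        · rw [image_eq_zero_of_notMem_tsupport fun h => hd.le_bot ⟨h3 hx, k3 h⟩, add_zero]
          exact h4 x
        · rw [image_eq_zero_of_notMem_tsupport hx, zero_add]
          exact k4 x
    · rw [ENNReal.ofReal_of_nonpos hq, add_zero]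
      exact ofReal_pairing_le u hφ (h3.trans subset_union_left) h4
  · rw [ENNReal.ofReal_of_nonpos hp, zero_add]
    exact ofReal_pairing_le u hψ (k3.trans subset_union_right) k4

/-- The outer measure given by `varMeasure`. -/
def varOuter (u : Ed d → ℝ) : OuterMeasure (Ed d) :=
  inducedOuterMeasure (P := IsOpen) (fun Ω _ => variationOn u Ω) isOpen_empty
    (variationOn_empty u)

theorem varOuter_eq (hu : LocallyIntegrable u) (hV : variation u < ⊤) (s : Set (Ed d)) :
    varOuter u s = varMeasure u s :=
  inducedOuterMeasure_eq_iInf (fun _ hf => isOpen_iUnion hf)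
    (fun _ hf => variationOn_iUnion_le hu hV hf) (fun _ _ _ _ h => variationOn_mono h) s

theorem varMeasure_open {Ω : Set (Ed d)} (hΩ : IsOpen Ω) :
    varMeasure u Ω = variationOn u Ω :=
  le_antisymm (iInf_le_of_le Ω (iInf_le_of_le hΩ (iInf_le _ subset_rfl)))
    (le_iInf fun _ => le_iInf fun _ => le_iInf fun h => variationOn_mono h)

theorem varOuter_isMetric (hu : LocallyIntegrable u) (hV : variation u < ⊤) :
    (varOuter u).IsMetric := by
  intro s t hst
  refine le_antisymm (measure_union_le s t) ?_
  obtain ⟨U, V, hU, hV', hsU, htV, hUV⟩ := Metric.AreSeparated.separatedNhds hst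
  rw [varOuter_eq hu hV (s ∪ t)]
  refine le_iInf fun Ω => le_iInf fun hΩ => le_iInf fun h => ?_
  calc varOuter u s + varOuter u t
      ≤ variationOn u (Ω ∩ U) + variationOn u (Ω ∩ V) := by
        rw [varOuter_eq hu hV, varOuter_eq hu hV]
        gcongr
        · exact iInf_le_of_le (Ω ∩ U) (iInf_le_of_le (hΩ.inter hU) (iInf_le _
            (subset_inter (subset_union_left.trans h) hsU)))
        · exact iInf_le_of_le (Ω ∩ V) (iInf_le_of_le (hΩ.inter hV') (iInf_le _
            (subset_inter (subset_union_right.trans h) htV)))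
    _ ≤ variationOn u (Ω ∩ U ∪ Ω ∩ V) :=
        variationOn_add_le hu (hUV.mono inter_subset_right inter_subset_right)
    _ ≤ variationOn u Ω := variationOn_mono (union_subset inter_subset_left inter_subset_left)

/-- The variation measure `|Du|` as a Borel measure. -/
def varM (hu : LocallyIntegrable u) (hV : variation u < ⊤) : Measure (Ed d) :=
  (varOuter u).toMeasure
    ((BorelSpace.measurable_eq (α := Ed d)).le.trans
      (varOuter_isMetric hu hV).borel_le_caratheodory)

theorem varM_open (hu : LocallyIntegrable u) (hV : variation u < ⊤) {Ω : Set (Ed d)}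
    (hΩ : IsOpen Ω) : varM hu hV Ω = variationOn u Ω := by
  rw [varM, toMeasure_apply _ _ hΩ.measurableSet, varOuter_eq hu hV, varMeasure_open hΩ]

theorem varM_le_varMeasure (hu : LocallyIntegrable u) (hV : variation u < ⊤) (s : Set (Ed d)) :
    varM hu hV s ≤ varMeasure u s :=
  le_iInf fun _ => le_iInf fun hΩ => le_iInf fun h =>
    (measure_mono h).trans (varM_open hu hV hΩ).le

theorem varMeasure_le_varM (hu : LocallyIntegrable u) (hV : variation u < ⊤) (s : Set (Ed d)) :
    varMeasure u s ≤ varM hu hV s := by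
  rw [← varOuter_eq hu hV]
  exact le_toMeasure_apply _ _ s

instance isFiniteMeasure_varM (hu : LocallyIntegrable u) (hV : variation u < ⊤) :
    IsFiniteMeasure (varM hu hV) :=
  ⟨by rw [varM_open hu hV isOpen_univ]; exact hV⟩

theorem varM_real_open (hu : LocallyIntegrable u) (hV : variation u < ⊤) {Ω : Set (Ed d)}
    (hΩ : IsOpen Ω) : (varM hu hV).real Ω = (variationOn u Ω).toReal := by
  rw [measureReal_def, varM_open hu hV hΩ]

end VariationMeasure

section Polar

variable {d : ℕ} {u : Ed d → ℝ} {φ : Ed d → Ed d}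

theorem card_near_le_two (N : ℕ) (t : ℝ) (ht : 0 ≤ t) :
    (Finset.univ.filter fun k : Fin N => (k : ℝ) - 1 < t ∧ t < k + 1).card ≤ 2 := by
  have hsub : (Finset.univ.filter fun k : Fin N => (k : ℝ) - 1 < t ∧ t < k + 1).map
      Fin.valEmbedding ⊆ {⌊t⌋₊, ⌊t⌋₊ + 1} := by
    intro k hk
    simp only [Finset.mem_map, Finset.mem_filter, Finset.mem_univ, true_and] at hk
    obtain ⟨j, ⟨h1, h2⟩, rfl⟩ := hk
    have h3 := Nat.floor_le ht
    have h4 := Nat.lt_floor_add_one t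
    have h5 : (⌊t⌋₊ : ℝ) < (j : ℕ) + 1 := h3.trans_lt h2
    have h6 : ((j : ℕ) : ℝ) < (⌊t⌋₊ : ℝ) + 1 + 1 := by linarith
    norm_cast at h5 h6
    simp only [Fin.valEmbedding_apply, Finset.mem_insert, Finset.mem_singleton]
    omega
  calc _ = _ := (Finset.card_map _).symm
    _ ≤ _ := Finset.card_le_card hsub
    _ ≤ 2 := Finset.card_le_two

theorem pairing_le_integral (hu : LocallyIntegrable u) (hV : variation u < ⊤) (hφ : IsTest φ) :
    pairing u φ ≤ 2 * ∫ x, ‖φ x‖ ∂(varM hu hV) := by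
  set μ := varM hu hV
  have hint : Integrable (fun x => ‖φ x‖) μ :=
    (hφ.continuous.integrable_of_hasCompactSupport hφ.hasCompactSupport).norm
  obtain ⟨M, hM⟩ := hφ.continuous.bounded_above_of_compact_support hφ.hasCompactSupport
  have key : ∀ ε : ℝ, 0 < ε → pairing u φ ≤ 2 * ∫ x, ‖φ x‖ ∂μ + 4 * μ.real univ * ε := by
    intro ε hε
    obtain ⟨N, hN⟩ := exists_nat_gt (M / ε)
    set Ω : Fin (N + 1) → Set (Ed d) := fun k =>
      {x | ((k : ℝ) - 1) * ε < ‖φ x‖ ∧ ‖φ x‖ < ((k : ℝ) + 1) * ε} with hΩdef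
    have hΩ : ∀ k, IsOpen (Ω k) := fun k =>
      (isOpen_lt continuous_const hφ.continuous.norm).inter
        (isOpen_lt hφ.continuous.norm continuous_const)
    have hcov : tsupport φ ⊆ ⋃ k, Ω k := by
      intro x _
      have h1 : ‖φ x‖ / ε < N := (div_le_div_of_nonneg_right (hM x) hε.le).trans_lt hN
      have h0 : 0 ≤ ‖φ x‖ / ε := by positivity
      have h2 : ⌊‖φ x‖ / ε⌋₊ < N + 1 := ((Nat.floor_lt h0).2 h1).trans (Nat.lt_succ_self N)
      refine mem_iUnion.2 ⟨⟨_, h2⟩, ?_, ?_⟩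
      · rw [← lt_div_iff₀ hε]
        have := Nat.floor_le h0
        simp only
        linarith
      · rw [← div_lt_iff₀ hε]
        exact Nat.lt_floor_add_one _
    have h := pairing_le_sum hu hV hφ hΩ hcov (c := fun k => ((k : ℝ) + 1) * ε)
      (fun k => by positivity) (fun k x hx => hx.2.le)
    refine h.trans ?_
    have h1 : ∀ k : Fin (N + 1), ((k : ℝ) + 1) * ε * (variationOn u (Ω k)).toReal ≤
        ∫ x, (Ω k).indicator (fun x => ‖φ x‖ + 2 * ε) x ∂μ := by
      intro k
      rw [← varM_real_open hu hV (hΩ k), integral_indicator (hΩ k).measurableSet]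
      calc ((k : ℝ) + 1) * ε * μ.real (Ω k) = ∫ x in Ω k, ((k : ℝ) + 1) * ε ∂μ := by
            rw [setIntegral_const, smul_eq_mul, mul_comm]
        _ ≤ _ := by
          refine setIntegral_mono_on (integrable_const _).integrableOn
            (hint.add (integrable_const _)).integrableOn (hΩ k).measurableSet fun x hx => ?_
          have := hx.1
          linarith
    have hg : ∀ k, Integrable ((Ω k).indicator (fun x => ‖φ x‖ + 2 * ε)) μ := fun k =>
      (hint.add (integrable_const _)).indicator (hΩ k).measurableSet
    calc _ ≤ ∑ k, ∫ x, (Ω k).indicator (fun x => ‖φ x‖ + 2 * ε) x ∂μ :=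
          Finset.sum_le_sum fun k _ => h1 k
      _ = ∫ x, ∑ k, (Ω k).indicator (fun x => ‖φ x‖ + 2 * ε) x ∂μ :=
          (integral_finsetSum _ fun k _ => hg k).symm
      _ ≤ ∫ x, 2 * (‖φ x‖ + 2 * ε) ∂μ := by
          refine integral_mono (integrable_finsetSum _ fun k _ => hg k)
            ((hint.add (integrable_const _)).const_mul 2) fun x => ?_
          classical
          simp only [indicator_apply]
          rw [← Finset.sum_filter, Finset.sum_const, nsmul_eq_mul]
          refine mul_le_mul_of_nonneg_right ?_ (by positivity)
          have := card_near_le_two (N + 1) (‖φ x‖ / ε) (by positivity)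
          simp only [lt_div_iff₀ hε, div_lt_iff₀ hε] at this
          have hc : (Finset.univ.filter fun k => x ∈ Ω k).card ≤ 2 := by
            convert this
            exact Iff.rfl
          exact_mod_cast hc
      _ = 2 * ∫ x, ‖φ x‖ ∂μ + 4 * μ.real univ * ε := by
          rw [integral_const_mul, integral_add hint (integrable_const _), integral_const,
            smul_eq_mul]
          ring
  refine le_of_forall_pos_le_add fun δ hδ => ?_
  have h0 : 0 ≤ μ.real univ := measureReal_nonneg
  refine (key (δ / (4 * μ.real univ + 1)) (by positivity)).trans ?_
  gcongr
  rw [mul_div_assoc', div_le_iff₀ (by positivity)]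
  nlinarith

theorem abs_pairing_le_integral (hu : LocallyIntegrable u) (hV : variation u < ⊤)
    (hφ : IsTest φ) : |pairing u φ| ≤ 2 * ∫ x, ‖φ x‖ ∂(varM hu hV) := by
  refine abs_le.2 ⟨?_, pairing_le_integral hu hV hφ⟩
  have := pairing_le_integral hu hV (hφ.const_smul (-1))
  rw [pairing_const_smul u hφ] at this
  simp only [neg_smul, one_smul, norm_neg] at this
  linarith

/-- A linear functional dominated by the norm of a linear map into a Hilbert space is represented
by a vector. -/
theorem exists_inner_eq_of_abs_le {M H : Type*} [AddCommGroup M] [Module ℝ M]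
    [NormedAddCommGroup H] [InnerProductSpace ℝ H] [CompleteSpace H] (T : M →ₗ[ℝ] H)
    (L : M →ₗ[ℝ] ℝ) (C : ℝ) (h : ∀ m, |L m| ≤ C * ‖T m‖) :
    ∃ g : H, ∀ m, L m = inner ℝ g (T m) := by
  have hker : LinearMap.ker T ≤ LinearMap.ker L := by
    intro m hm
    have := h m
    rw [LinearMap.mem_ker.1 hm, norm_zero, mul_zero] at this
    exact LinearMap.mem_ker.2 (abs_nonpos_iff.1 this)
  let L' : LinearMap.range T →ₗ[ℝ] ℝ :=
    ((LinearMap.ker T).liftQ L hker).comp T.quotKerEquivRange.symm.toLinearMap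
  have hL' : ∀ m, L' ⟨T m, LinearMap.mem_range_self T m⟩ = L m := by
    intro m
    have : T.quotKerEquivRange.symm ⟨T m, LinearMap.mem_range_self T m⟩ =
        (LinearMap.ker T).mkQ m := by
      rw [LinearEquiv.symm_apply_eq]
      rfl
    simp only [L', LinearMap.comp_apply, LinearEquiv.coe_coe, this]
    simp
  have hb : ∀ y : LinearMap.range T, ‖L' y‖ ≤ C * ‖y‖ := by
    rintro ⟨_, m, rfl⟩
    rw [hL' m]
    exact h m
  obtain ⟨G, hG, -⟩ := exists_extension_norm_eq (LinearMap.range T) (L'.mkContinuous C hb)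
  refine ⟨(InnerProductSpace.toDual ℝ H).symm G, fun m => ?_⟩
  rw [InnerProductSpace.toDual_symm_apply, ← hL' m]
  exact (hG ⟨T m, LinearMap.mem_range_self T m⟩).symm

/-- The submodule of test fields. -/
def testFields (d : ℕ) : Submodule ℝ (Ed d → Ed d) where
  carrier := {φ | IsTest φ}
  add_mem' h h' := h.add h'
  zero_mem' := IsTest.zero
  smul_mem' c _ h := h.const_smul c

theorem IsTest.memLp (h : IsTest φ) (μ : Measure (Ed d)) [IsFiniteMeasure μ] :
    MemLp φ 2 μ :=
  h.continuous.memLp_of_hasCompactSupport h.hasCompactSupport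

/-- Riesz representation of the distributional gradient. -/
theorem exists_density (hu : LocallyIntegrable u) (hV : variation u < ⊤) :
    ∃ σ : Ed d → Ed d, MemLp σ 2 (varM hu hV) ∧
      ∀ φ, IsTest φ → pairing u φ = ∫ x, inner ℝ (σ x) (φ x) ∂(varM hu hV) := by
  set μ := varM hu hV with hμ
  let T : testFields d →ₗ[ℝ] Lp (Ed d) 2 μ :=
    { toFun := fun φ => (IsTest.memLp φ.2 μ).toLp φ.1
      map_add' := fun φ ψ => MemLp.toLp_add _ _
      map_smul' := fun c φ => MemLp.toLp_const_smul c _ }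
  let L : testFields d →ₗ[ℝ] ℝ :=
    { toFun := fun φ => pairing u φ.1
      map_add' := fun φ ψ => pairing_add hu φ.2 ψ.2
      map_smul' := fun c φ => pairing_const_smul u φ.2 c }
  obtain ⟨g, hg⟩ := exists_inner_eq_of_abs_le T L (2 * Real.sqrt (μ.real univ)) (by
    rintro ⟨φ, hφ⟩
    have hφ' : IsTest φ := hφ
    refine (abs_pairing_le_integral hu hV hφ').trans ?_
    rw [mul_assoc]
    refine mul_le_mul_of_nonneg_left ?_ zero_le_two
    change _ ≤ _ * ‖(hφ'.memLp μ).toLp φ‖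
    rw [Lp.norm_toLp]
    have h1 : ∫ x, ‖φ x‖ ∂μ = (eLpNorm φ 1 μ).toReal := by
      rw [eLpNorm_one_eq_lintegral_enorm, integral_norm_eq_lintegral_enorm
        hφ'.continuous.aestronglyMeasurable]
    have h2 := eLpNorm_le_eLpNorm_mul_rpow_measure_univ (μ := μ) (p := 1) (q := 2) (f := φ)
      (by norm_num) hφ'.continuous.aestronglyMeasurable
    rw [h1, mul_comm]
    refine (ENNReal.toReal_mono ?_ h2).trans_eq ?_
    · exact ENNReal.mul_ne_top (hφ'.memLp μ).eLpNorm_ne_top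
        (ENNReal.rpow_ne_top_of_nonneg (by norm_num) (measure_ne_top _ _))
    · rw [ENNReal.toReal_mul, ← ENNReal.toReal_rpow, Real.sqrt_eq_rpow, measureReal_def]
      norm_num)
  refine ⟨g, Lp.memLp g, fun φ hφ => ?_⟩
  have := hg ⟨φ, hφ⟩
  rw [L2.inner_def] at this
  refine this.trans (integral_congr_ae ?_)
  filter_upwards [(hφ.memLp μ).coeFn_toLp] with x hx
  change inner ℝ (g x) (((hφ.memLp μ).toLp φ) x) = _
  rw [hx]

theorem one_le_norm_density (hu : LocallyIntegrable u) (hV : variation u < ⊤)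
    {σ : Ed d → Ed d} (hσ : MemLp σ 2 (varM hu hV))
    (h : ∀ φ, IsTest φ → pairing u φ = ∫ x, inner ℝ (σ x) (φ x) ∂(varM hu hV)) :
    ∀ᵐ x ∂(varM hu hV), 1 ≤ ‖σ x‖ := by
  set μ := varM hu hV with hμ
  have hint : Integrable σ μ := hσ.integrable one_le_two
  set ν := μ.withDensity fun x => ‖σ x‖ₑ with hν
  have : IsFiniteMeasure ν := isFiniteMeasure_withDensity hint.2.ne
  have hopen : ∀ Ω, IsOpen Ω → μ Ω ≤ ν Ω := by
    intro Ω hΩ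
    rw [hμ, varM_open hu hV hΩ]
    refine variationOn_le fun φ hφ hs h1 => ?_
    rw [h φ hφ, hν, withDensity_apply _ hΩ.measurableSet,
      ← ofReal_integral_norm_eq_lintegral_enorm hint.integrableOn]
    refine ENNReal.ofReal_le_ofReal ?_
    rw [← integral_indicator hΩ.measurableSet]
    calc ∫ x, inner ℝ (σ x) (φ x) ∂μ ≤ ∫ x, |inner ℝ (σ x) (φ x)| ∂μ :=
          (le_abs_self _).trans abs_integral_le_integral_abs
      _ ≤ ∫ x, Ω.indicator (fun x => ‖σ x‖) x ∂μ := by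
          refine integral_mono_of_nonneg (Eventually.of_forall fun x => abs_nonneg _)
            (hint.norm.indicator hΩ.measurableSet) (Eventually.of_forall fun x => ?_)
          by_cases hx : x ∈ Ω
          · simp only [indicator_of_mem hx]
            exact (abs_real_inner_le_norm _ _).trans (mul_le_of_le_one_right (norm_nonneg _) (h1 x))
          · simp only [indicator_of_notMem hx]
            rw [image_eq_zero_of_notMem_tsupport fun h => hx (hs h)]
            simp
  have hmeas : ∀ s, MeasurableSet s → μ s ≤ ν s := by
    intro s _
    refine le_of_forall_gt fun r hr => ?_
    obtain ⟨U, hsU, hU, hr'⟩ := Set.exists_isOpen_lt_of_lt s r hr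
    exact (measure_mono hsU).trans_lt ((hopen U hU).trans_lt hr')
  have hae : (fun _ => (1 : ℝ≥0∞)) ≤ᵐ[μ] fun x => ‖σ x‖ₑ := by
    refine ae_le_of_forall_setLIntegral_le_of_sigmaFinite₀ aemeasurable_const fun s hs _ => ?_
    rw [setLIntegral_one, ← withDensity_apply _ hs]
    exact hmeas s hs
  filter_upwards [hae] with x hx
  rw [← ofReal_norm, ENNReal.one_le_ofReal] at hx
  exact hx

end Polar

section RadialCutoff

variable {d : ℕ}

/-- A smooth radially decreasing cutoff, equal to `1` on the unit ball. -/
def cutoff (y : Ed d) : ℝ := Real.smoothTransition (2 - ‖y‖ ^ 2)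

theorem cutoff_nonneg (y : Ed d) : 0 ≤ cutoff y := Real.smoothTransition.nonneg _

theorem cutoff_le_one (y : Ed d) : cutoff y ≤ 1 := Real.smoothTransition.le_one _

theorem cutoff_eq_one {y : Ed d} (h : ‖y‖ ≤ 1) : cutoff y = 1 :=
  Real.smoothTransition.one_of_one_le (by nlinarith [norm_nonneg y])

theorem cutoff_eq_zero {y : Ed d} (h : 3 / 2 ≤ ‖y‖) : cutoff y = 0 :=
  Real.smoothTransition.zero_of_nonpos (by nlinarith)

theorem cutoff_anti {y z : Ed d} (h : ‖y‖ ≤ ‖z‖) : cutoff z ≤ cutoff y :=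
  Real.smoothTransition.monotone (by nlinarith [norm_nonneg y])

theorem contDiff_cutoff : ContDiff ℝ (⊤ : ℕ∞) (cutoff (d := d)) :=
  Real.smoothTransition.contDiff.comp (contDiff_const.sub (contDiff_norm_sq ℝ))

theorem hasCompactSupport_cutoff : HasCompactSupport (cutoff (d := d)) :=
  HasCompactSupport.intro (isCompact_closedBall 0 (3 / 2)) fun y hy =>
    cutoff_eq_zero (by simpa using (not_le.1 (mt mem_closedBall_zero_iff.2 hy)).le)

/-- The cutoff equal to `1` on `B(x, R)` and to `0` off `B(x, (3 / 2) R)`. -/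
def cutoffAt (x : Ed d) (R : ℝ) (y : Ed d) : ℝ := cutoff (R⁻¹ • (y - x))

theorem contDiff_cutoffAt (x : Ed d) (R : ℝ) : ContDiff ℝ (⊤ : ℕ∞) (cutoffAt x R) :=
  contDiff_cutoff.comp ((contDiff_id.sub contDiff_const).const_smul R⁻¹)

theorem norm_inv_smul_sub (x y : Ed d) {R : ℝ} (hR : 0 < R) :
    ‖R⁻¹ • (y - x)‖ = dist y x / R := by
  rw [norm_smul, norm_inv, Real.norm_of_nonneg hR.le, dist_eq_norm]
  ring

theorem cutoffAt_eq_one {x y : Ed d} {R : ℝ} (hR : 0 < R) (h : dist y x ≤ R) :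
    cutoffAt x R y = 1 :=
  cutoff_eq_one (by rw [norm_inv_smul_sub x y hR]; exact (div_le_one hR).2 h)

theorem cutoffAt_eq_zero {x y : Ed d} {R : ℝ} (hR : 0 < R) (h : 3 / 2 * R ≤ dist y x) :
    cutoffAt x R y = 0 :=
  cutoff_eq_zero (by rw [norm_inv_smul_sub x y hR]; exact (le_div_iff₀ hR).2 h)

theorem cutoffAt_anti {x y z : Ed d} {R : ℝ} (hR : 0 < R) (h : dist y x ≤ dist z x) :
    cutoffAt x R z ≤ cutoffAt x R y := by
  refine cutoff_anti ?_
  rw [norm_inv_smul_sub x y hR, norm_inv_smul_sub x z hR]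
  gcongr

theorem cutoffAt_nonneg (x : Ed d) (R : ℝ) (y : Ed d) : 0 ≤ cutoffAt x R y := cutoff_nonneg _

theorem cutoffAt_le_one (x : Ed d) (R : ℝ) (y : Ed d) : cutoffAt x R y ≤ 1 := cutoff_le_one _

theorem tsupport_cutoffAt (x : Ed d) {R : ℝ} (hR : 0 < R) :
    tsupport (cutoffAt x R) ⊆ closedBall x (3 / 2 * R) := by
  refine closure_minimal (fun y hy => ?_) isClosed_closedBall
  by_contra hy'
  exact hy (cutoffAt_eq_zero hR (not_le.1 (mt mem_closedBall.2 hy')).le)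

theorem hasCompactSupport_cutoffAt (x : Ed d) {R : ℝ} (hR : 0 < R) :
    HasCompactSupport (cutoffAt x R) :=
  (isCompact_closedBall x _).of_isClosed_subset (isClosed_tsupport _) (tsupport_cutoffAt x hR)

theorem exists_norm_fderiv_cutoffAt_le (d : ℕ) : ∃ M : ℝ, 0 < M ∧ ∀ (x : Ed d) (R : ℝ), 0 < R →
    ∀ y, ‖fderiv ℝ (cutoffAt x R) y‖ ≤ M / R := by
  obtain ⟨M, hM⟩ := (contDiff_cutoff (d := d).continuous_fderiv
    (by simp)).bounded_above_of_compact_support (hasCompactSupport_cutoff.fderiv ℝ)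
  refine ⟨max M 1, by positivity, fun x R hR y => ?_⟩
  have h1 : HasFDerivAt (fun y : Ed d => R⁻¹ • (y - x)) (R⁻¹ • ContinuousLinearMap.id ℝ (Ed d)) y :=
    ((hasFDerivAt_id y).sub_const x).const_smul R⁻¹
  have h2 : HasFDerivAt (cutoffAt x R)
      ((fderiv ℝ cutoff (R⁻¹ • (y - x))).comp (R⁻¹ • ContinuousLinearMap.id ℝ (Ed d))) y :=
    ((contDiff_cutoff.differentiable (by simp)) _).hasFDerivAt.comp y h1
  rw [h2.fderiv, ContinuousLinearMap.comp_smul, ContinuousLinearMap.comp_id, norm_smul, norm_inv,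
    Real.norm_of_nonneg hR.le, div_eq_inv_mul]
  gcongr
  exact (hM _).trans (le_max_left _ _)

theorem superlevel_cutoffAt (x : Ed d) {R t : ℝ} (hR : 0 < R) (ht : 0 < t) (ht1 : t ≤ 1) :
    ∃ s, 0 < s ∧ s < 2 * R ∧ {y | t ≤ cutoffAt x R y} = closedBall x s := by
  set A := {y | t ≤ cutoffAt x R y}
  have hcl : IsClosed A := isClosed_le continuous_const (contDiff_cutoffAt x R).continuous
  have hA : A ⊆ closedBall x (3 / 2 * R) := fun y hy => by
    by_contra hy'
    have := cutoffAt_eq_zero hR (not_le.1 (mt mem_closedBall.2 hy')).le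
    exact (ht.trans_le hy).ne' this
  have hxA : ∀ y, dist y x ≤ R → y ∈ A := fun y hy => by
    change t ≤ cutoffAt x R y
    rwa [cutoffAt_eq_one hR hy]
  obtain ⟨y0, hy0, hmax⟩ := ((isCompact_closedBall x _).of_isClosed_subset hcl hA).exists_isMaxOn
    ⟨x, hxA x (by simpa using hR.le)⟩
    (f := fun y => dist y x) (continuous_id.dist continuous_const).continuousOn
  refine ⟨max R (dist y0 x), lt_max_of_lt_left hR, max_lt (by linarith) ?_, ?_⟩
  · have := mem_closedBall.1 (hA hy0)
    linarith
  · ext y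
    rw [mem_closedBall, le_max_iff]
    refine ⟨fun hy => Or.inr (hmax hy), ?_⟩
    rintro (h | h)
    · exact hxA y h
    · exact le_trans hy0 (cutoffAt_anti hR h)

/-- Comparison of two measures on concentric balls integrates to radially decreasing cutoffs. -/
theorem lintegral_cutoffAt_le {ρ ρ' : Measure (Ed d)} {x : Ed d} {R : ℝ} (hR : 0 < R)
    (h : ∀ s, 0 < s → s < 2 * R → ρ (closedBall x s) ≤ ρ' (closedBall x s)) :
    ∫⁻ y, ENNReal.ofReal (cutoffAt x R y) ∂ρ ≤ ∫⁻ y, ENNReal.ofReal (cutoffAt x R y) ∂ρ' := by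
  have hm := (contDiff_cutoffAt x R).continuous.measurable
  rw [lintegral_eq_lintegral_meas_le ρ (Eventually.of_forall (cutoffAt_nonneg x R)) hm.aemeasurable,
    lintegral_eq_lintegral_meas_le ρ' (Eventually.of_forall (cutoffAt_nonneg x R)) hm.aemeasurable]
  refine setLIntegral_mono_ae' measurableSet_Ioi (Eventually.of_forall fun t ht => ?_)
  rcases le_or_gt t 1 with h1 | h1
  · obtain ⟨s, hs, hs', heq⟩ := superlevel_cutoffAt x hR ht h1
    rw [heq]
    exact h s hs hs'
  · have : {y | t ≤ cutoffAt x R y} = ∅ :=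
      eq_empty_of_forall_notMem fun y hy => (h1.trans_le hy).not_ge (cutoffAt_le_one x R y)
    simp [this]

end RadialCutoff

theorem pairing_sub_const {d : ℕ} {u : Ed d → ℝ} (hu : LocallyIntegrable u) {φ : Ed d → Ed d}
    (h : IsTest φ) (c : ℝ) : ∫ x, (u x - c) * vdiv φ x = pairing u φ := by
  simp only [sub_mul]
  rw [integral_sub (h.integrable_mul hu) (h.integrable_vdiv.const_mul c), integral_const_mul,
    integral_vdiv h, mul_zero, sub_zero, pairing]

/-- At almost every point of the variation measure, its mass on small balls is controlled by the
oscillation of the function. -/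
theorem exists_variation_le_oscillation (d : ℕ) : ∃ C : ℝ, 0 < C ∧ ∀ (u : Ed d → ℝ)
    (hu : LocallyIntegrable u) (hV : variation u < ⊤), ∀ᵐ x ∂(varM hu hV), ∃ r₀ > 0, ∀ R, 0 < R →
      R < r₀ → ∀ c, (varM hu hV).real (closedBall x R) ≤
        C / R * ∫ y in closedBall x (2 * R), |u y - c| := by
  obtain ⟨M, hM0, hM⟩ := exists_norm_fderiv_cutoffAt_le d
  refine ⟨2 * M, by positivity, fun u hu hV => ?_⟩
  obtain ⟨σ, hσ, hrep⟩ := exists_density hu hV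
  set μ := varM hu hV
  have hσi : Integrable σ μ := hσ.integrable one_le_two
  filter_upwards [one_le_norm_density hu hV hσ hrep,
    (Besicovitch.vitaliFamily μ).ae_tendsto_lintegral_enorm_sub_div hσi.locallyIntegrable]
    with x hx1 hx2
  have hx0 : 0 < ‖σ x‖ := zero_lt_one.trans_le hx1
  set a := ENNReal.ofReal (‖σ x‖ / 2)
  have ha : 0 < a := ENNReal.ofReal_pos.2 (by positivity)
  have hev := (hx2.comp (Besicovitch.tendsto_filterAt μ x)).eventually (gt_mem_nhds ha)
  obtain ⟨r, hr, hball⟩ := mem_nhdsGT_iff_exists_Ioo_subset.1 hev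
  refine ⟨r / 2, half_pos hr, fun R hR hRr c => ?_⟩
  set η := cutoffAt x R
  have hηm : Measurable η := (contDiff_cutoffAt x R).continuous.measurable
  have hηi : Integrable η μ := (contDiff_cutoffAt x R).continuous.integrable_of_hasCompactSupport
    (hasCompactSupport_cutoffAt x hR)
  have hηb : ∀ y, ‖η y‖ ≤ 1 := fun y => by
    rw [Real.norm_of_nonneg (cutoffAt_nonneg x R y)]
    exact cutoffAt_le_one x R y
  have htest : IsTest (fun y => η y • σ x) :=
    IsTest.smul_vec (contDiff_cutoffAt x R) (hasCompactSupport_cutoffAt x hR) _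
  have hη2 : Integrable (fun y => η y * ‖σ y - σ x‖) μ :=
    (hσi.sub (integrable_const _)).norm.bdd_mul (c := 1) hηm.aestronglyMeasurable
      (Eventually.of_forall hηb)
  have hosc : ∫ y, η y * ‖σ y - σ x‖ ∂μ ≤ ‖σ x‖ / 2 * ∫ y, η y ∂μ := by
    have hmeas : AEMeasurable (fun y => ‖σ y - σ x‖ₑ) μ :=
      (hσi.sub (integrable_const (σ x))).1.enorm
    have hl := lintegral_cutoffAt_le (ρ := μ.withDensity fun y => ‖σ y - σ x‖ₑ) (ρ' := a • μ) hR
      fun s hs hs' => by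
        have h := hball ⟨hs, by linarith⟩
        rw [withDensity_apply _ measurableSet_closedBall, Measure.smul_apply, smul_eq_mul]
        exact (ENNReal.div_le_iff_le_mul (Or.inr ENNReal.ofReal_ne_top) (Or.inr ha.ne')).1 h.le
    rw [lintegral_smul_measure, lintegral_withDensity_eq_lintegral_mul₀
      hmeas hηm.ennreal_ofReal.aemeasurable] at hl
    rw [integral_eq_lintegral_of_nonneg_ae (Eventually.of_forall fun y =>
        mul_nonneg (cutoffAt_nonneg x R y) (norm_nonneg _)) hη2.1,
      integral_eq_lintegral_of_nonneg_ae (Eventually.of_forall (cutoffAt_nonneg x R)) hηi.1,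
      ← ENNReal.toReal_ofReal (by positivity : 0 ≤ ‖σ x‖ / 2), ← ENNReal.toReal_mul]
    refine ENNReal.toReal_mono (ENNReal.mul_ne_top ENNReal.ofReal_ne_top ?_) (le_trans ?_ hl)
    · exact hηi.lintegral_lt_top.ne
    · refine lintegral_mono fun y => ?_
      rw [ENNReal.ofReal_mul (cutoffAt_nonneg x R y), ofReal_norm, mul_comm]
      rfl
  have hlow : ‖σ x‖ ^ 2 / 2 * ∫ y, η y ∂μ ≤ pairing u (fun y => η y • σ x) := by
    rw [hrep _ htest]
    have hi : Integrable (fun y => ‖σ x‖ ^ 2 * η y - ‖σ x‖ * (η y * ‖σ y - σ x‖)) μ :=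
      (hηi.const_mul _).sub (hη2.const_mul _)
    have hin : Integrable (fun y => inner ℝ (σ y) (η y • σ x)) μ := by
      simp only [inner_smul_right]
      exact (hσi.inner_const (σ x)).bdd_mul (c := 1) hηm.aestronglyMeasurable
        (Eventually.of_forall hηb)
    calc _ ≤ ∫ y, (‖σ x‖ ^ 2 * η y - ‖σ x‖ * (η y * ‖σ y - σ x‖)) ∂μ := by
          rw [integral_sub (hηi.const_mul _) (hη2.const_mul _), integral_const_mul,
            integral_const_mul]
          nlinarith
      _ ≤ _ := by
          refine integral_mono hi hin fun y => ?_
          have h1 := real_inner_le_norm (σ x - σ y) (σ x)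
          rw [inner_sub_left, real_inner_self_eq_norm_sq, norm_sub_rev] at h1
          simp only [inner_smul_right]
          nlinarith [mul_le_mul_of_nonneg_left h1 (cutoffAt_nonneg x R y)]
  have hη1 : μ.real (closedBall x R) ≤ ∫ y, η y ∂μ := by
    rw [← integral_indicator_one measurableSet_closedBall]
    refine integral_mono ((integrable_const _).indicator measurableSet_closedBall) hηi fun y => ?_
    by_cases hy : y ∈ closedBall x R
    · rw [indicator_of_mem hy]
      exact (cutoffAt_eq_one hR hy).ge
    · rw [indicator_of_notMem hy]
      exact cutoffAt_nonneg x R y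
  have hup : pairing u (fun y => η y • σ x) ≤
      ‖σ x‖ * (M / R) * ∫ y in closedBall x (2 * R), |u y - c| := by
    have hloc : IntegrableOn (fun y => |u y - c|) (closedBall x (2 * R)) :=
      ((hu.sub (locallyIntegrable_const c)).integrableOn_isCompact (isCompact_closedBall x _)).norm
    rw [← pairing_sub_const hu htest c, ← integral_const_mul,
      ← integral_indicator measurableSet_closedBall]
    refine integral_mono (htest.integrable_mul (hu.sub (locallyIntegrable_const c)))
      ((integrable_indicator_iff measurableSet_closedBall).2 (hloc.const_mul _)) fun y => ?_
    rw [vdiv_smul_vec ((contDiff_cutoffAt x R).differentiable (by simp) y)]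
    by_cases hy : y ∈ closedBall x (2 * R)
    · rw [indicator_of_mem hy]
      have h1 := (fderiv ℝ η y).le_of_opNorm_le (hM x R hR y) (σ x)
      calc (u y - c) * fderiv ℝ η y (σ x) ≤ |(u y - c) * fderiv ℝ η y (σ x)| := le_abs_self _
        _ = |u y - c| * ‖fderiv ℝ η y (σ x)‖ := by rw [abs_mul, Real.norm_eq_abs]
        _ ≤ |u y - c| * (M / R * ‖σ x‖) := by gcongr
        _ = _ := by ring
    · have h0 : fderiv ℝ (cutoffAt x R) y = 0 := by
        by_contra h0
        refine hy (closedBall_subset_closedBall (by linarith)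
          (tsupport_cutoffAt x hR (support_fderiv_subset ℝ h0)))
      simp [h0, indicator_of_notMem hy]
  have h3 : ‖σ x‖ ^ 2 / 2 * μ.real (closedBall x R) ≤
      ‖σ x‖ * (M / R) * ∫ y in closedBall x (2 * R), |u y - c| :=
    (mul_le_mul_of_nonneg_left hη1 (by positivity)).trans (hlow.trans hup)
  have hI : 0 ≤ ∫ y in closedBall x (2 * R), |u y - c| := integral_nonneg fun _ => abs_nonneg _
  set I := ∫ y in closedBall x (2 * R), |u y - c|
  have h4 : ‖σ x‖ * μ.real (closedBall x R) ≤ 2 * M / R * I := by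
    have : ‖σ x‖ * (‖σ x‖ * μ.real (closedBall x R)) ≤ ‖σ x‖ * (2 * M / R * I) := by
      calc _ = 2 * (‖σ x‖ ^ 2 / 2 * μ.real (closedBall x R)) := by ring
        _ ≤ 2 * (‖σ x‖ * (M / R) * I) := by gcongr
        _ = _ := by ring
    exact le_of_mul_le_mul_left this hx0
  exact (le_mul_of_one_le_left measureReal_nonneg hx1).trans h4

section Mollification

variable {d : ℕ} {u : Ed d → ℝ} {Φ : Ed d → Ed d}

/-- The bump functions used for mollification. -/
def mollBump (d n : ℕ) : ContDiffBump (0 : Ed d) where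
  rIn := 1 / (2 * (n + 1))
  rOut := 1 / (n + 1)
  rIn_pos := by positivity
  rIn_lt_rOut := by
    have : (0 : ℝ) < n + 1 := by positivity
    gcongr
    linarith

/-- The mollification kernel. -/
def mollKernel (d n : ℕ) : Ed d → ℝ := (mollBump d n).normed volume

/-- The mollification of a function. -/
def moll (u : Ed d → ℝ) (n : ℕ) : Ed d → ℝ :=
  mollKernel d n ⋆[ContinuousLinearMap.lsmul ℝ ℝ, volume] u

theorem moll_apply (u : Ed d → ℝ) (n : ℕ) (x : Ed d) :
    moll u n x = ∫ t, mollKernel d n t * u (x - t) := rfl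

theorem mollKernel_nonneg (d n : ℕ) (x : Ed d) : 0 ≤ mollKernel d n x :=
  (mollBump d n).nonneg_normed x

theorem continuous_mollKernel (d n : ℕ) : Continuous (mollKernel d n) :=
  (mollBump d n).continuous_normed

theorem hasCompactSupport_mollKernel (d n : ℕ) : HasCompactSupport (mollKernel d n) :=
  (mollBump d n).hasCompactSupport_normed

theorem integral_mollKernel (d n : ℕ) : ∫ x, mollKernel d n x = 1 :=
  (mollBump d n).integral_normed

theorem integrable_mollKernel (d n : ℕ) : Integrable (mollKernel d n) :=
  (continuous_mollKernel d n).integrable_of_hasCompactSupport (hasCompactSupport_mollKernel d n)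

theorem mollKernel_eq_zero {n : ℕ} {x : Ed d} (h : 1 / ((n : ℝ) + 1) ≤ ‖x‖) :
    mollKernel d n x = 0 := by
  by_contra hx
  have : x ∈ Function.support (mollKernel d n) := hx
  rw [mollKernel, ContDiffBump.support_normed_eq, mem_ball_zero_iff] at this
  exact this.not_ge h

theorem contDiff_moll (hu : LocallyIntegrable u) (n : ℕ) : ContDiff ℝ (⊤ : ℕ∞) (moll u n) :=
  (hasCompactSupport_mollKernel d n).contDiff_convolution_left _ (mollBump d n).contDiff_normed hu

theorem integrable_moll_integrand (hu : LocallyIntegrable u) (n : ℕ) (x : Ed d) :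
    Integrable fun t => mollKernel d n t * u (x - t) :=
  (hasCompactSupport_mollKernel d n).convolutionExists_left (ContinuousLinearMap.lsmul ℝ ℝ)
    (continuous_mollKernel d n) hu x

theorem moll_nonneg (h0 : ∀ x, 0 ≤ u x) (n : ℕ) (x : Ed d) : 0 ≤ moll u n x :=
  integral_nonneg fun t => mul_nonneg (mollKernel_nonneg d n t) (h0 _)

theorem moll_le_one (hu : LocallyIntegrable u) (h1 : ∀ x, u x ≤ 1) (n : ℕ) (x : Ed d) :
    moll u n x ≤ 1 := by
  rw [← integral_mollKernel d n, moll_apply]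
  exact integral_mono (integrable_moll_integrand hu n x) (integrable_mollKernel d n) fun t =>
    mul_le_of_le_one_right (mollKernel_nonneg d n t) (h1 _)

theorem tendsto_moll (hu : LocallyIntegrable u) :
    ∀ᵐ x, Tendsto (fun n => moll u n x) atTop (𝓝 (u x)) :=
  ContDiffBump.ae_convolution_tendsto_right_of_locallyIntegrable (K := 2) (φ := mollBump d)
    tendsto_one_div_add_atTop_nhds_zero_nat
    (Eventually.of_forall fun n => le_of_eq (by
      change 1 / ((n : ℝ) + 1) = 2 * (1 / (2 * (n + 1)))
      field_simp)) hu

theorem pairing_moll (hu : LocallyIntegrable u) (hΦ : IsTest Φ) (n : ℕ) :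
    pairing (moll u n) Φ = ∫ t, mollKernel d n t * pairing u (fun x => Φ (x + t)) := by
  obtain ⟨ρ, hρ⟩ := hΦ.hasCompactSupport_vdiv.isBounded.subset_closedBall (0 : Ed d)
  set v : Ed d → ℝ := (closedBall 0 (ρ + 1)).indicator u
  have hv : Integrable v := (integrable_indicator_iff measurableSet_closedBall).2
    (hu.integrableOn_isCompact (isCompact_closedBall _ _))
  have heq : ∀ x t, mollKernel d n t * u (x - t) * vdiv Φ x =
      mollKernel d n t * v (x - t) * vdiv Φ x := by
    intro x t
    by_cases hx : vdiv Φ x = 0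
    · simp [hx]
    by_cases ht : 1 / ((n : ℝ) + 1) ≤ ‖t‖
    · simp [mollKernel_eq_zero ht]
    have h1 : ‖x‖ ≤ ρ := mem_closedBall_zero_iff.1 (hρ (subset_tsupport _ hx))
    have h2 : ‖t‖ ≤ 1 := (not_le.1 ht).le.trans (by
      rw [div_le_one (by positivity)]
      linarith [n.cast_nonneg (α := ℝ)])
    have h3 : x - t ∈ closedBall 0 (ρ + 1) :=
      mem_closedBall_zero_iff.2 ((norm_sub_le x t).trans (add_le_add h1 h2))
    simp only [v, indicator_of_mem h3]
  obtain ⟨M, hM⟩ := hΦ.continuous_vdiv.bounded_above_of_compact_support hΦ.hasCompactSupport_vdiv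
  have hprod : Integrable (fun p : Ed d × Ed d => mollKernel d n p.2 * u (p.1 - p.2) * vdiv Φ p.1)
      (volume.prod volume) := by
    simp only [heq]
    refine Integrable.mul_bdd (c := M) ?_
      (hΦ.continuous_vdiv.comp continuous_fst).aestronglyMeasurable
      (Eventually.of_forall fun p => hM _)
    exact Integrable.convolution_integrand (ContinuousLinearMap.lsmul ℝ ℝ)
      (integrable_mollKernel d n) hv
  calc pairing (moll u n) Φ = ∫ x, ∫ t, mollKernel d n t * u (x - t) * vdiv Φ x := by
        unfold pairing
        simp only [moll_apply, integral_mul_const]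
    _ = ∫ t, ∫ x, mollKernel d n t * u (x - t) * vdiv Φ x := integral_integral_swap hprod
    _ = _ := by
        congr 1 with t
        simp only [mul_assoc, integral_const_mul, pairing, vdiv_comp_add_right]
        rw [← integral_sub_right_eq_self (fun x => u x * vdiv Φ (x + t)) t]
        simp

theorem pairing_moll_le (hu : LocallyIntegrable u) {Ω : Set (Ed d)} (hV : variationOn u Ω < ⊤)
    (hΦ : IsTest Φ) {n : ℕ} (hs : cthickening (1 / ((n : ℝ) + 1)) (tsupport Φ) ⊆ Ω) {c : ℝ}
    (hc : 0 ≤ c) (hb : ∀ x, ‖Φ x‖ ≤ c) :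
    pairing (moll u n) Φ ≤ c * (variationOn u Ω).toReal := by
  rw [pairing_moll hu hΦ]
  by_cases hi : Integrable fun t => mollKernel d n t * pairing u (fun x => Φ (x + t))
  swap
  · rw [integral_undef hi]
    positivity
  calc _ ≤ ∫ t, mollKernel d n t * (c * (variationOn u Ω).toReal) := by
        refine integral_mono hi ((integrable_mollKernel d n).mul_const _) fun t => ?_
        by_cases ht : 1 / ((n : ℝ) + 1) ≤ ‖t‖
        · simp [mollKernel_eq_zero ht]
        refine mul_le_mul_of_nonneg_left ?_ (mollKernel_nonneg d n t)
        refine pairing_le_mul_toReal hV (hΦ.comp_add_right t) ?_ hc fun x => hb _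
        refine (tsupport_comp_subset_preimage Φ (continuous_add_const t)).trans fun x hx => hs ?_
        refine mem_cthickening_of_dist_le x (x + t) _ _ hx ?_
        rw [dist_eq_norm, sub_add_cancel_left, norm_neg]
        exact (not_le.1 ht).le
    _ = _ := by rw [integral_mul_const, integral_mollKernel, one_mul]

theorem pairing_moll_le_variation (hu : LocallyIntegrable u) (hV : variation u < ⊤)
    (hΦ : IsTest Φ) (n : ℕ) {c : ℝ} (hc : 0 ≤ c) (hb : ∀ x, ‖Φ x‖ ≤ c) :
    pairing (moll u n) Φ ≤ c * (variation u).toReal :=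
  pairing_moll_le hu hV hΦ (subset_univ _) hc hb

theorem eventually_pairing_moll_le (hu : LocallyIntegrable u) {Ω K : Set (Ed d)}
    (hV : variationOn u Ω < ⊤) (hK : IsCompact K) (hΩ : IsOpen Ω) (hKΩ : K ⊆ Ω) :
    ∀ᶠ n in atTop, ∀ Φ : Ed d → Ed d, IsTest Φ → tsupport Φ ⊆ K → ∀ c : ℝ, 0 ≤ c →
      (∀ x, ‖Φ x‖ ≤ c) → pairing (moll u n) Φ ≤ c * (variationOn u Ω).toReal := by
  obtain ⟨δ, hδ, hsub⟩ := hK.exists_cthickening_subset_open hΩ hKΩ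
  filter_upwards [tendsto_one_div_add_atTop_nhds_zero_nat.eventually (gt_mem_nhds hδ)]
    with n hn Φ hΦ hs c hc hb
  exact pairing_moll_le hu hV hΦ
    ((cthickening_mono hn.le _).trans ((cthickening_subset_of_subset _ hs).trans hsub)) hc hb

end Mollification

section Composition

variable {d : ℕ} {u : Ed d → ℝ}

theorem tendsto_pairing {v : ℕ → Ed d → ℝ} {C : ℝ} (hm : ∀ n, AEStronglyMeasurable (v n) volume)
    (hb : ∀ n x, |v n x| ≤ C) (h : ∀ᵐ x, Tendsto (fun n => v n x) atTop (𝓝 (u x)))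
    {φ : Ed d → Ed d} (hφ : IsTest φ) :
    Tendsto (fun n => pairing (v n) φ) atTop (𝓝 (pairing u φ)) := by
  refine tendsto_integral_of_dominated_convergence (fun x => C * |vdiv φ x|)
    (fun n => (hm n).mul hφ.continuous_vdiv.aestronglyMeasurable)
    (hφ.integrable_vdiv.abs.const_mul C) (fun n => Eventually.of_forall fun x => ?_) ?_
  · rw [norm_mul, Real.norm_eq_abs, Real.norm_eq_abs]
    exact mul_le_mul_of_nonneg_right (hb n x) (abs_nonneg _)
  · filter_upwards [h] with x hx
    exact hx.mul_const _

theorem variationOn_comp_le (hu : LocallyIntegrable u) {ψ : ℝ → ℝ} (hψ : ContDiff ℝ (⊤ : ℕ∞) ψ)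
    {B C : ℝ} (hB : ∀ s, |ψ s| ≤ B) (hC : ∀ s, |deriv ψ s| ≤ C) {Ω : Set (Ed d)} (hΩ : IsOpen Ω)
    (hV : variationOn u Ω < ⊤) :
    variationOn (fun x => ψ (u x)) Ω ≤ ENNReal.ofReal C * variationOn u Ω := by
  have hC0 : 0 ≤ C := (abs_nonneg _).trans (hC 0)
  refine variationOn_le fun φ hφ hs h1 => ?_
  rw [← ENNReal.ofReal_toReal hV.ne, ← ENNReal.ofReal_mul hC0]
  refine ENNReal.ofReal_le_ofReal ?_
  have ht : Tendsto (fun n => pairing (fun x => ψ (moll u n x)) φ) atTop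
      (𝓝 (pairing (fun x => ψ (u x)) φ)) :=
    tendsto_pairing (fun n => (hψ.continuous.comp
      (contDiff_moll hu n).continuous).aestronglyMeasurable) (fun n x => hB _)
      ((tendsto_moll hu).mono fun x hx => (hψ.continuous.tendsto _).comp hx) hφ
  refine le_of_tendsto ht ?_
  filter_upwards [eventually_pairing_moll_le hu hV hφ.hasCompactSupport hΩ hs] with n hn
  rw [pairing_comp_smooth (contDiff_moll hu n) hψ hφ]
  have hψ' : ContDiff ℝ (⊤ : ℕ∞) (deriv ψ) := (contDiff_infty_iff_deriv.1 hψ).2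
  refine hn _ (hφ.smul (hψ'.comp (contDiff_moll hu n))) (tsupport_smul_fun_subset _ _) C hC0
    fun x => ?_
  rw [norm_smul, Real.norm_eq_abs, ← mul_one C]
  exact mul_le_mul (hC _) (h1 x) (norm_nonneg _) hC0

end Composition

section Translation

variable {d : ℕ} {u : Ed d → ℝ}

/-- Difference quotients of test functions against a function of bounded variation. -/
theorem integral_mul_translate_sub_le (hu : LocallyIntegrable u) {Ω : Set (Ed d)}
    (hV : variationOn u Ω < ⊤) {g : Ed d → ℝ} (hg : ContDiff ℝ (⊤ : ℕ∞) g)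
    (hgc : HasCompactSupport g) (hg1 : ∀ x, |g x| ≤ 1) (z : Ed d)
    (hs : cthickening ‖z‖ (tsupport g) ⊆ Ω) :
    ∫ x, u x * (g (x + z) - g x) ≤ ‖z‖ * (variationOn u Ω).toReal := by
  have hT : IsTest fun x => g x • z := IsTest.smul_vec hg hgc z
  have hdiff : Differentiable ℝ g := hg.differentiable (by simp)
  have hvd : ∀ (t : ℝ) x, vdiv (fun x => g (x + t • z) • z) x = fderiv ℝ g (x + t • z) z := by
    intro t x
    rw [vdiv_comp_add_right (fun x => g x • z), vdiv_smul_vec (hdiff _)]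
  have hcont : Continuous fun p : Ed d × ℝ => fderiv ℝ g (p.1 + p.2 • z) z :=
    ((hg.continuous_fderiv (by simp)).comp (by fun_prop)).clm_apply continuous_const
  have hftc : ∀ x, g (x + z) - g x = ∫ t in Ioc (0 : ℝ) 1, fderiv ℝ g (x + t • z) z := by
    intro x
    have hd : ∀ t ∈ uIcc (0 : ℝ) 1, HasDerivAt (fun t : ℝ => g (x + t • z))
        (fderiv ℝ g (x + t • z) z) t := by
      intro t _
      have h1 : HasDerivAt (fun t : ℝ => x + t • z) z t := by
        simpa using ((hasDerivAt_id t).smul_const z).const_add x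
      exact (hdiff _).hasFDerivAt.comp_hasDerivAt t h1
    have hc : Continuous fun t : ℝ => fderiv ℝ g (x + t • z) z :=
      hcont.comp (continuous_const.prodMk continuous_id)
    rw [← intervalIntegral.integral_of_le zero_le_one,
      intervalIntegral.integral_eq_sub_of_hasDerivAt hd (hc.intervalIntegrable 0 1)]
    simp
  obtain ⟨ρ, hρ⟩ := hgc.isBounded.subset_closedBall (0 : Ed d)
  set v : Ed d → ℝ := (closedBall 0 (ρ + ‖z‖)).indicator u
  have hv : Integrable v := (integrable_indicator_iff measurableSet_closedBall).2
    (hu.integrableOn_isCompact (isCompact_closedBall _ _))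
  have heq : ∀ x, ∀ t ∈ Ioc (0 : ℝ) 1,
      u x * fderiv ℝ g (x + t • z) z = v x * fderiv ℝ g (x + t • z) z := by
    intro x t ht
    by_cases hx : fderiv ℝ g (x + t • z) = 0
    · simp [hx]
    have h1 : ‖x + t • z‖ ≤ ρ := mem_closedBall_zero_iff.1 (hρ (support_fderiv_subset ℝ hx))
    have h2 : ‖t • z‖ ≤ ‖z‖ := by
      rw [norm_smul, Real.norm_of_nonneg ht.1.le]
      exact mul_le_of_le_one_left (norm_nonneg _) ht.2
    have h3 : x ∈ closedBall 0 (ρ + ‖z‖) := by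
      refine mem_closedBall_zero_iff.2 ?_
      have := norm_sub_le (x + t • z) (t • z)
      rw [add_sub_cancel_right] at this
      exact this.trans (add_le_add h1 h2)
    simp only [v, indicator_of_mem h3]
  obtain ⟨M, hM⟩ := (hg.continuous_fderiv (by simp)).bounded_above_of_compact_support
    (hgc.fderiv ℝ)
  have hprod : Integrable (fun p : Ed d × ℝ => v p.1 * fderiv ℝ g (p.1 + p.2 • z) z)
      (volume.prod (volume.restrict (Ioc (0 : ℝ) 1))) :=
    (hv.comp_fst _).mul_bdd (c := M * ‖z‖) hcont.aestronglyMeasurable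
      (Eventually.of_forall fun p => (fderiv ℝ g _).le_of_opNorm_le (hM _) z)
  calc ∫ x, u x * (g (x + z) - g x)
      = ∫ x, ∫ t in Ioc (0 : ℝ) 1, v x * fderiv ℝ g (x + t • z) z := by
        congr 1 with x
        rw [hftc, ← integral_const_mul]
        exact setIntegral_congr_fun measurableSet_Ioc fun t ht => heq x t ht
    _ = ∫ t in Ioc (0 : ℝ) 1, ∫ x, v x * fderiv ℝ g (x + t • z) z := integral_integral_swap hprod
    _ ≤ ∫ t in Ioc (0 : ℝ) 1, ‖z‖ * (variationOn u Ω).toReal := by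
        refine setIntegral_mono_on hprod.integral_prod_right
          (integrableOn_const (by simp)) measurableSet_Ioc fun t ht => ?_
        have h1 : ∫ x, v x * fderiv ℝ g (x + t • z) z =
            pairing u (fun x => g (x + t • z) • z) := by
          unfold pairing
          simp only [hvd, ← heq _ t ht]
        rw [h1]
        refine pairing_le_mul_toReal hV (hT.comp_add_right (t • z)) ?_ (norm_nonneg z) fun x => ?_
        · refine (tsupport_comp_subset_preimage (fun x => g x • z)
            (continuous_add_const (t • z))).trans fun x hx => hs ?_
          have hx' : x + t • z ∈ tsupport g :=
            closure_mono (Function.support_smul_subset_left g fun _ => z) hx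
          refine mem_cthickening_of_dist_le x (x + t • z) _ _ hx' ?_
          rw [dist_eq_norm, sub_add_cancel_left, norm_neg, norm_smul, Real.norm_of_nonneg ht.1.le]
          exact mul_le_of_le_one_left (norm_nonneg _) ht.2
        · rw [norm_smul]
          exact mul_le_of_le_one_left (norm_nonneg _) (hg1 _)
    _ = _ := by simp

end Translation

section Contraction

variable {d : ℕ} {E : Set (Ed d)}

theorem locallyIntegrable_indicator_one (hE : MeasurableSet E) :
    LocallyIntegrable (E.indicator fun _ => (1 : ℝ)) :=
  (locallyIntegrable_const (1 : ℝ)).indicator hE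

theorem indicator_one_nonneg (E : Set (Ed d)) (x : Ed d) : 0 ≤ E.indicator (fun _ => (1 : ℝ)) x :=
  indicator_nonneg (fun _ _ => zero_le_one) x

theorem indicator_one_le_one (E : Set (Ed d)) (x : Ed d) : E.indicator (fun _ => (1 : ℝ)) x ≤ 1 :=
  indicator_le_self' (fun _ _ => zero_le_one) x

theorem indicator_compl_one (E : Set (Ed d)) (x : Ed d) :
    Eᶜ.indicator (fun _ => (1 : ℝ)) x = 1 - E.indicator (fun _ => (1 : ℝ)) x := by
  by_cases hx : x ∈ E <;> simp [hx]

/-- `L¹` modulus of continuity of a set of finite perimeter, localised by a cutoff. -/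
theorem integral_cutoff_compl_le (hE : MeasurableSet E) {x₀ : Ed d} {ρ : ℝ} (hρ : 0 < ρ)
    (hV : variationOn (E.indicator fun _ => (1 : ℝ)) (ball x₀ (2 * ρ)) < ⊤) {z : Ed d}
    (hz : ‖z‖ ≤ ρ / 4) :
    (∫ x, cutoffAt x₀ ρ x * Eᶜ.indicator (fun _ => 1) x) -
      ∫ x, cutoffAt x₀ ρ x * Eᶜ.indicator (fun _ => 1) x * Eᶜ.indicator (fun _ => 1) (x - z) ≤
      ‖z‖ * (variationOn (E.indicator fun _ => (1 : ℝ)) (ball x₀ (2 * ρ))).toReal := by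
  set u : Ed d → ℝ := E.indicator fun _ => 1
  set η := cutoffAt x₀ ρ
  have hu : LocallyIntegrable u := locallyIntegrable_indicator_one hE
  have hum : Measurable u := measurable_const.indicator hE
  have hη : ContDiff ℝ (⊤ : ℕ∞) η := contDiff_cutoffAt x₀ ρ
  have hηc : HasCompactSupport η := hasCompactSupport_cutoffAt x₀ hρ
  have hηi : Integrable η := hη.continuous.integrable_of_hasCompactSupport hηc
  set g : ℕ → Ed d → ℝ := fun n x => η x * (1 - moll u n x)
  have hg : ∀ n, ContDiff ℝ (⊤ : ℕ∞) (g n) := fun n =>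
    hη.mul (contDiff_const.sub (contDiff_moll hu n))
  have hgb : ∀ n x, |g n x| ≤ η x := fun n x => by
    have h0 := moll_nonneg (indicator_one_nonneg E) n x
    have h1 := moll_le_one hu (indicator_one_le_one E) n x
    have h2 := cutoffAt_nonneg x₀ ρ x
    rw [abs_of_nonneg (mul_nonneg h2 (by linarith))]
    exact mul_le_of_le_one_right h2 (by linarith)
  have hgs : ∀ n, tsupport (g n) ⊆ tsupport η := fun n =>
    closure_mono (Function.support_mul_subset_left _ _)
  have hle : ∀ n, ∫ x, u x * (g n (x + z) - g n x) ≤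
      ‖z‖ * (variationOn u (ball x₀ (2 * ρ))).toReal := fun n => by
    refine integral_mul_translate_sub_le hu hV (hg n)
      (hηc.of_isClosed_subset (isClosed_tsupport _) (hgs n))
      (fun x => (hgb n x).trans (cutoffAt_le_one _ _ _)) z ?_
    refine (cthickening_subset_of_subset _ ((hgs n).trans (tsupport_cutoffAt x₀ hρ))).trans ?_
    rw [cthickening_closedBall (by positivity) (by positivity)]
    exact closedBall_subset_ball (by linarith)
  have hlim : ∀ᵐ x, Tendsto (fun n => g n x) atTop (𝓝 (η x * (1 - u x))) := by
    filter_upwards [tendsto_moll hu] with x hx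
    exact (hx.const_sub 1).const_mul _
  have hlim' : ∀ᵐ x, Tendsto (fun n => g n (x + z)) atTop (𝓝 (η (x + z) * (1 - u (x + z)))) :=
    (measurePreserving_add_right volume z).quasiMeasurePreserving.tendsto_ae.eventually hlim
  have hmain : Tendsto (fun n => ∫ x, u x * (g n (x + z) - g n x)) atTop
      (𝓝 (∫ x, u x * (η (x + z) * (1 - u (x + z)) - η x * (1 - u x)))) := by
    refine tendsto_integral_of_dominated_convergence (fun x => η (x + z) + η x)
      (fun n => (hum.mul (((hg n).continuous.comp (continuous_add_const z)).sub
        (hg n).continuous).measurable).aestronglyMeasurable)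
      ((hηi.comp_add_right z).add hηi) (fun n => Eventually.of_forall fun x => ?_) ?_
    · rw [norm_mul, Real.norm_of_nonneg (indicator_one_nonneg E x), Real.norm_eq_abs]
      calc _ ≤ |g n (x + z) - g n x| :=
            mul_le_of_le_one_left (abs_nonneg _) (indicator_one_le_one E x)
        _ ≤ |g n (x + z)| + |g n x| := abs_sub _ _
        _ ≤ _ := add_le_add (hgb n _) (hgb n _)
    · filter_upwards [hlim, hlim'] with x h1 h2
      exact (h2.sub h1).const_mul _
  refine le_trans (le_of_eq ?_) (le_of_tendsto' hmain hle)
  have hcb : ∀ x, ‖Eᶜ.indicator (fun _ => (1 : ℝ)) x‖ ≤ 1 := fun x => by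
    rw [Real.norm_of_nonneg (indicator_one_nonneg _ x)]
    exact indicator_one_le_one _ x
  have hcm : Measurable (Eᶜ.indicator fun _ => (1 : ℝ)) := measurable_const.indicator hE.compl
  have hI1 : Integrable fun x => η x * Eᶜ.indicator (fun _ => 1) x :=
    hηi.mul_bdd (c := 1) hcm.aestronglyMeasurable (Eventually.of_forall hcb)
  have hI2 : Integrable fun x => η x * Eᶜ.indicator (fun _ => 1) x *
      Eᶜ.indicator (fun _ => 1) (x - z) :=
    hI1.mul_bdd (c := 1) (hcm.comp (measurable_sub_const z)).aestronglyMeasurable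
      (Eventually.of_forall fun x => hcb _)
  rw [← integral_sub hI1 hI2, ← integral_add_right_eq_self (fun x =>
    η x * Eᶜ.indicator (fun _ => (1 : ℝ)) x - η x * Eᶜ.indicator (fun _ => 1) x *
      Eᶜ.indicator (fun _ => 1) (x - z)) z]
  congr 1 with x
  have hidem : u x * (1 - u x) = 0 := by
    by_cases hx : x ∈ E <;> simp [u, hx]
  simp only [indicator_compl_one, add_sub_cancel_right]
  linear_combination η x * hidem

/-- If the complement of a set has small volume in a ball, then its volume in a smaller ball is
controlled by the perimeter. -/
theorem compl_volume_le_perimeter (hE : MeasurableSet E) {x₀ : Ed d} {ρ s : ℝ} (hρ : 0 < ρ)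
    (hV : variationOn (E.indicator fun _ => (1 : ℝ)) (ball x₀ (2 * ρ)) < ⊤) (hs : 0 < s)
    (hsρ : s ≤ ρ / 4)
    (hm : 2 * volume.real (Eᶜ ∩ closedBall x₀ (2 * ρ)) ≤ volume.real (closedBall (0 : Ed d) s)) :
    volume.real (Eᶜ ∩ closedBall x₀ ρ) ≤
      2 * s * (variationOn (E.indicator fun _ => (1 : ℝ)) (ball x₀ (2 * ρ))).toReal := by
  set V := (variationOn (E.indicator fun _ => (1 : ℝ)) (ball x₀ (2 * ρ))).toReal
  set c : Ed d → ℝ := Eᶜ.indicator fun _ => 1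
  set h : Ed d → ℝ := fun x => cutoffAt x₀ ρ x * c x
  have hc0 : ∀ x, 0 ≤ c x := indicator_one_nonneg _
  have hc1 : ∀ x, c x ≤ 1 := indicator_one_le_one _
  have hcb : ∀ x, ‖c x‖ ≤ 1 := fun x => by
    rw [Real.norm_of_nonneg (hc0 x)]
    exact hc1 x
  have hcm : Measurable c := measurable_const.indicator hE.compl
  have h0 : ∀ x, 0 ≤ h x := fun x => mul_nonneg (cutoffAt_nonneg _ _ _) (hc0 x)
  have hh : Integrable h := ((contDiff_cutoffAt x₀ ρ).continuous.integrable_of_hasCompactSupport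
    (hasCompactSupport_cutoffAt x₀ hρ)).mul_bdd (c := 1) hcm.aestronglyMeasurable
    (Eventually.of_forall hcb)
  set m := volume.real (Eᶜ ∩ closedBall x₀ (2 * ρ))
  set b := volume.real (closedBall (0 : Ed d) s)
  have hb : 0 < b := ENNReal.toReal_pos (measure_closedBall_pos volume 0 hs).ne'
    measure_closedBall_lt_top.ne
  set I := ∫ x, h x
  have hlow : volume.real (Eᶜ ∩ closedBall x₀ ρ) ≤ I := by
    rw [← integral_indicator_one (hE.compl.inter measurableSet_closedBall)]
    refine integral_mono_of_nonneg (Eventually.of_forall fun x => indicator_one_nonneg _ x) hh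
      (Eventually.of_forall fun x => ?_)
    by_cases hx : x ∈ Eᶜ ∩ closedBall x₀ ρ
    · rw [indicator_of_mem hx]
      simp [h, c, indicator_of_mem hx.1, cutoffAt_eq_one hρ (mem_closedBall.1 hx.2)]
    · rw [indicator_of_notMem hx]
      exact h0 x
  have hprod : Integrable (fun p : Ed d × Ed d => h p.1 * c (p.1 - p.2))
      (volume.prod (volume.restrict (closedBall 0 s))) := by
    have : IsFiniteMeasure ((volume : Measure (Ed d)).restrict (closedBall 0 s)) :=
      ⟨by simpa using measure_closedBall_lt_top⟩
    exact (hh.comp_fst _).mul_bdd (c := 1)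
      (hcm.comp (measurable_fst.sub measurable_snd)).aestronglyMeasurable
      (Eventually.of_forall fun p => hcb _)
  have h1 : b * (I - s * V) ≤ ∫ z in closedBall (0 : Ed d) s, ∫ x, h x * c (x - z) := by
    have : ∫ z in closedBall (0 : Ed d) s, (I - s * V) = b * (I - s * V) := by
      rw [setIntegral_const, smul_eq_mul]
    rw [← this]
    refine setIntegral_mono_on (integrableOn_const measure_closedBall_lt_top.ne)
      hprod.integral_prod_right measurableSet_closedBall fun z hz => ?_
    have hz' : ‖z‖ ≤ s := mem_closedBall_zero_iff.1 hz
    have := integral_cutoff_compl_le hE hρ hV (hz'.trans hsρ)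
    have h2 : ‖z‖ * V ≤ s * V := mul_le_mul_of_nonneg_right hz' ENNReal.toReal_nonneg
    change I - ∫ x, h x * c (x - z) ≤ ‖z‖ * V at this
    linarith
  have h2 : ∫ z in closedBall (0 : Ed d) s, ∫ x, h x * c (x - z) ≤ I * m := by
    rw [← integral_integral_swap hprod, ← integral_mul_const]
    refine integral_mono hprod.integral_prod_left (hh.mul_const m) fun x => ?_
    simp only [integral_const_mul]
    by_cases hx : 3 / 2 * ρ ≤ dist x x₀
    · simp [h, cutoffAt_eq_zero hρ hx]
    refine mul_le_mul_of_nonneg_left ?_ (h0 x)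
    have hmi : m = ∫ y, (Eᶜ ∩ closedBall x₀ (2 * ρ)).indicator 1 y :=
      (integral_indicator_one (hE.compl.inter measurableSet_closedBall)).symm
    rw [← integral_indicator measurableSet_closedBall, ← integral_sub_left_eq_self _ volume x, hmi]
    refine integral_mono_of_nonneg (Eventually.of_forall fun y => ?_)
      ((integrable_indicator_iff (hE.compl.inter measurableSet_closedBall)).2
        (integrableOn_const ?_)) (Eventually.of_forall fun y => ?_)
    · exact indicator_nonneg (fun _ _ => hc0 _) _
    · exact (measure_mono inter_subset_right).trans_lt measure_closedBall_lt_top |>.ne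
    · by_cases hy : x - y ∈ closedBall 0 s
      · simp only [indicator_of_mem hy, sub_sub_cancel]
        have : y ∈ closedBall x₀ (2 * ρ) := by
          rw [mem_closedBall_zero_iff, ← dist_eq_norm, dist_comm] at hy
          have := dist_triangle y x x₀
          rw [mem_closedBall]
          linarith
        by_cases hyE : y ∈ Eᶜ
        · rw [indicator_of_mem (show y ∈ Eᶜ ∩ closedBall x₀ (2 * ρ) from ⟨hyE, this⟩)]
          exact hc1 y
        · simp only [c, indicator_of_notMem hyE]
          exact indicator_one_nonneg _ y
      · simp only [indicator_of_notMem hy]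
        exact indicator_one_nonneg _ y
  have hI : 0 ≤ I := integral_nonneg h0
  have h3 : b * (I - s * V) ≤ b * (I / 2) := by
    refine (h1.trans h2).trans ?_
    nlinarith
  have h4 := le_of_mul_le_mul_left h3 hb
  linarith

end Contraction

section Density

variable {d : ℕ} {E : Set (Ed d)}

/-- The volume of a ball of radius `s` in `ℝ^d`. -/
def ballVol (d : ℕ) (s : ℝ) : ℝ := volume.real (closedBall (0 : Ed d) s)

/-- The volume of the part of the ball `B(x, r)` outside `E`. -/
def complVol (E : Set (Ed d)) (x : Ed d) (r : ℝ) : ℝ := volume.real (Eᶜ ∩ closedBall x r)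

theorem volume_real_closedBall (x : Ed d) (s : ℝ) : volume.real (closedBall x s) = ballVol d s := by
  rw [ballVol, measureReal_def, measureReal_def, Measure.addHaar_closedBall_center]

theorem ballVol_pos (d : ℕ) {s : ℝ} (hs : 0 < s) : 0 < ballVol d s :=
  ENNReal.toReal_pos (measure_closedBall_pos volume 0 hs).ne' measure_closedBall_lt_top.ne

theorem ballVol_mul (d : ℕ) {c s : ℝ} (hc : 0 ≤ c) (hs : 0 ≤ s) :
    ballVol d (c * s) = c ^ d * ballVol d s := by
  simp only [ballVol, measureReal_def]
  rw [Measure.addHaar_closedBall _ _ (mul_nonneg hc hs), Measure.addHaar_closedBall _ _ hs,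
    mul_pow, ENNReal.ofReal_mul (by positivity), mul_assoc, ENNReal.toReal_mul,
    finrank_euclideanSpace_fin, ENNReal.toReal_ofReal (by positivity)]

theorem complVol_nonneg (E : Set (Ed d)) (x : Ed d) (r : ℝ) : 0 ≤ complVol E x r :=
  measureReal_nonneg

theorem volume_inter_closedBall_ne_top (s : Set (Ed d)) (x : Ed d) (r : ℝ) :
    volume (s ∩ closedBall x r) ≠ ⊤ :=
  ((measure_mono inter_subset_right).trans_lt measure_closedBall_lt_top).ne

theorem complVol_mono (E : Set (Ed d)) (x : Ed d) {r r' : ℝ} (h : r ≤ r') :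
    complVol E x r ≤ complVol E x r' :=
  measureReal_mono (inter_subset_inter_right _ (closedBall_subset_closedBall h))
    (volume_inter_closedBall_ne_top _ _ _)

theorem toReal_density (hE : MeasurableSet E) (x : Ed d) {r : ℝ} (hr : 0 < r) :
    (volume (E ∩ ball x r) / volume (ball x r)).toReal = 1 - complVol E x r / ballVol d r := by
  have hae : ball x r =ᵐ[volume] closedBall x r := by
    rw [← ball_union_sphere]
    exact (union_ae_eq_left_of_ae_eq_empty
      (ae_eq_empty.2 (Measure.addHaar_sphere_of_ne_zero volume x hr.ne'))).symm
  have h1 : volume (E ∩ ball x r) = volume (E ∩ closedBall x r) :=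
    measure_congr (EventuallyEq.rfl.inter hae)
  rw [measure_congr hae, h1, ENNReal.toReal_div]
  have h2 := measureReal_inter_add_sdiff (μ := volume) (s := closedBall x r) hE
    measure_closedBall_lt_top.ne
  have hb := ballVol_pos d hr
  rw [volume_real_closedBall, sdiff_eq, inter_comm, inter_comm _ Eᶜ] at h2
  change volume.real _ / volume.real _ = _
  rw [volume_real_closedBall, eq_sub_iff_add_eq, ← add_div, div_eq_one_iff_eq hb.ne']
  exact h2

theorem mem_densitySet_one_iff (hE : MeasurableSet E) (x : Ed d) :
    x ∈ densitySet E 1 ↔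
      Tendsto (fun r => complVol E x r / ballVol d r) (𝓝[>] 0) (𝓝 0) := by
  have hne : ∀ r, volume (E ∩ ball x r) / volume (ball x r) ≠ ⊤ := fun r =>
    ((ENNReal.div_le_of_le_mul (by
      rw [one_mul]
      exact measure_mono inter_subset_right) :
        volume (E ∩ ball x r) / volume (ball x r) ≤ 1).trans_lt ENNReal.one_lt_top).ne
  change Tendsto _ _ _ ↔ _
  rw [← ENNReal.tendsto_toReal_iff hne ENNReal.one_ne_top, ENNReal.toReal_one,
    tendsto_congr' (f₂ := fun r => 1 - complVol E x r / ballVol d r)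
      (by filter_upwards [self_mem_nhdsWithin] with r hr using toReal_density hE x hr)]
  refine ⟨fun h => ?_, fun h => ?_⟩
  · simpa using h.const_sub 1
  · simpa using h.const_sub 1

end Density

section LowerDensity

variable {d : ℕ} {E : Set (Ed d)}

theorem complVol_quarter_le (hE : MeasurableSet E)
    (hV : variation (E.indicator fun _ => (1 : ℝ)) < ⊤) (x : Ed d) {β r : ℝ} (hβ : 0 < β)
    (hβ' : β ≤ 1 / 16) (hr : 0 < r) (hm : 2 * complVol E x r ≤ ballVol d (β * r)) :
    complVol E x (r / 4) ≤ 2 * (β * r) *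
      (varM (locallyIntegrable_indicator_one hE) hV).real (closedBall x (r / 2)) := by
  have h1 : 2 * (r / 4) = r / 2 := by ring
  have h := compl_volume_le_perimeter hE (x₀ := x) (ρ := r / 4) (s := β * r) (by positivity)
    (variationOn_lt_top hV) (by positivity) (by nlinarith) (by
      rw [h1]
      exact (mul_le_mul_of_nonneg_left (complVol_mono E x (by linarith)) zero_le_two).trans hm)
  rw [h1, ← varM_real_open (locallyIntegrable_indicator_one hE) hV isOpen_ball] at h
  refine h.trans (mul_le_mul_of_nonneg_left ?_ (by positivity))
  exact measureReal_mono ball_subset_closedBall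

theorem eventually_real_le_mul {ρ μ : Measure (Ed d)} [IsFiniteMeasure μ] {x : Ed d}
    {K : ℝ} (hK : 0 < K) {L : ℝ≥0∞} (hL : L < ENNReal.ofReal K)
    (h : Tendsto (fun r => ρ (closedBall x r) / μ (closedBall x r)) (𝓝[>] 0) (𝓝 L)) :
    ∀ᶠ r in 𝓝[>] 0, ρ.real (closedBall x r) ≤ K * μ.real (closedBall x r) := by
  filter_upwards [h.eventually (gt_mem_nhds hL)] with r hr
  have h1 := (ENNReal.div_le_iff_le_mul (Or.inr ENNReal.ofReal_ne_top)
    (Or.inr (ENNReal.ofReal_pos.2 hK).ne')).1 hr.le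
  rw [measureReal_def, measureReal_def, ← ENNReal.toReal_ofReal hK.le, ← ENNReal.toReal_mul]
  exact ENNReal.toReal_mono (ENNReal.mul_ne_top ENNReal.ofReal_ne_top (measure_ne_top _ _)) h1

theorem setIntegral_abs_indicator_sub_one (hE : MeasurableSet E) (x : Ed d) (r : ℝ) :
    ∫ y in closedBall x r, |E.indicator (fun _ => (1 : ℝ)) y - 1| = complVol E x r := by
  have : ∀ y, |E.indicator (fun _ => (1 : ℝ)) y - 1| = Eᶜ.indicator 1 y := fun y => by
    by_cases hy : y ∈ E <;> simp [hy]
  simp only [this]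
  rw [integral_indicator_one hE.compl, measureReal_restrict_apply hE.compl]
  rfl

end LowerDensity

section LowerDensityBounds

variable {d : ℕ} {E : Set (Ed d)}

/-- Almost everywhere with respect to the perimeter measure, the complement has a definite volume
fraction in all small balls. -/
theorem lowerDensity_perimeter (hE : MeasurableSet E)
    (hV : variation (E.indicator fun _ => (1 : ℝ)) < ⊤) {x : Ed d} {C β r₀ : ℝ} (hβ : 0 < β)
    (hβ' : β ≤ 1 / 16) (hβC : 4 * β * C ≤ (1 / 4) ^ (d + 2)) (hr₀ : 0 < r₀)
    (hG : ∀ R, 0 < R → R < r₀ → ∀ c,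
      (varM (locallyIntegrable_indicator_one hE) hV).real (closedBall x R) ≤
        C / R * ∫ y in closedBall x (2 * R), |E.indicator (fun _ => (1 : ℝ)) y - c|)
    {K : ℝ} (hK : 0 < K) (hvol : ∀ᶠ r in 𝓝[>] (0 : ℝ), volume.real (closedBall x r) ≤
      K * (varM (locallyIntegrable_indicator_one hE) hV).real (closedBall x r)) :
    ∀ᶠ r in 𝓝[>] (0 : ℝ), ballVol d (β * r) < 2 * complVol E x r := by
  set μ := varM (locallyIntegrable_indicator_one hE) hV
  obtain ⟨r₁, hr₁, hvol⟩ := mem_nhdsGT_iff_exists_Ioo_subset.1 hvol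
  have hr₁ : 0 < r₁ := hr₁
  filter_upwards [Ioo_mem_nhdsGT (lt_min hr₀ hr₁)] with r hr
  have hr0 : 0 < r := hr.1
  by_contra! hcon
  have hμ : ∀ t, 0 < t → t ≤ r → μ.real (closedBall x (t / 2)) ≤ 2 * C / t * complVol E x t := by
    intro t ht htr
    have h := hG (t / 2) (half_pos ht) (by linarith [hr.2.trans_le (min_le_left _ _)]) 1
    rw [mul_div_cancel₀ t two_ne_zero, setIntegral_abs_indicator_sub_one hE] at h
    refine h.trans_eq ?_
    field_simp
  set q : ℝ := 1 / 4
  have hq : 0 < q := by norm_num [q]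
  have hq1 : q < 1 := by norm_num [q]
  have hit : ∀ k : ℕ, 2 * complVol E x (q ^ k * r) ≤ ballVol d (β * (q ^ k * r)) ∧
      complVol E x (q ^ k * r) ≤ (q ^ (d + 2)) ^ k * complVol E x r := by
    intro k
    induction k with
    | zero => simpa using hcon.trans_eq (by ring_nf)
    | succ k ih =>
      set t := q ^ k * r
      have ht : 0 < t := by positivity
      have htr : t ≤ r := mul_le_of_le_one_left hr0.le (pow_le_one₀ hq.le hq1.le)
      have ht' : q ^ (k + 1) * r = t / 4 := by
        simp only [t, pow_succ]
        simp only [q]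
        ring
      have h1 : complVol E x (t / 4) ≤ q ^ (d + 2) * complVol E x t := by
        refine (complVol_quarter_le hE hV x hβ hβ' ht ih.1).trans ?_
        calc 2 * (β * t) * μ.real (closedBall x (t / 2))
            ≤ 2 * (β * t) * (2 * C / t * complVol E x t) :=
              mul_le_mul_of_nonneg_left (hμ t ht htr) (by positivity)
          _ = 4 * β * C * complVol E x t := by
              field_simp
              ring
          _ ≤ _ := mul_le_mul_of_nonneg_right hβC (complVol_nonneg _ _ _)
      rw [ht']
      constructor
      · have h2 : ballVol d (β * (t / 4)) = q ^ d * ballVol d (β * t) := by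
          rw [← ballVol_mul d hq.le (by positivity)]
          congr 1
          simp only [q]
          ring
        rw [h2]
        have h3 : q ^ (d + 2) * complVol E x t ≤ q ^ d * complVol E x t :=
          mul_le_mul_of_nonneg_right (pow_le_pow_of_le_one hq.le hq1.le (by omega))
            (complVol_nonneg _ _ _)
        nlinarith [mul_le_mul_of_nonneg_left ih.1 (pow_nonneg hq.le d)]
      · rw [pow_succ', mul_assoc]
        exact h1.trans (mul_le_mul_of_nonneg_left ih.2 (by positivity))
  have hfin : ∀ k : ℕ, ballVol d (r / 2) ≤ q ^ k * (K * (2 * C / r) * complVol E x r) := by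
    intro k
    have hqk : 0 < q ^ k := by positivity
    have htr : q ^ k * r ≤ r := mul_le_of_le_one_left hr0.le (pow_le_one₀ hq.le hq1.le)
    have hC : 0 ≤ C := by
      by_contra! hC
      have h1 := hμ r hr0 le_rfl
      have h2 := hvol (show r / 2 ∈ Ioo 0 r₁ from
        ⟨half_pos hr0, by linarith [hr.2.trans_le (min_le_right _ _)]⟩)
      have h3 := ballVol_pos d (half_pos hr0)
      simp only [mem_ofPred_eq, volume_real_closedBall] at h2
      have h4 : 2 * C / r * complVol E x r ≤ 0 :=
        mul_nonpos_of_nonpos_of_nonneg (div_nonpos_of_nonpos_of_nonneg (by linarith) hr0.le)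
          (complVol_nonneg _ _ _)
      nlinarith
    have h1 := hvol (show q ^ k * r / 2 ∈ Ioo 0 r₁ from
      ⟨by positivity, by linarith [hr.2.trans_le (min_le_right _ _)]⟩)
    simp only [mem_ofPred_eq, volume_real_closedBall] at h1
    have h2 : ballVol d (q ^ k * r / 2) = (q ^ k) ^ d * ballVol d (r / 2) := by
      rw [← ballVol_mul d hqk.le (by positivity), mul_div_assoc]
    have h3 := hμ (q ^ k * r) (by positivity) htr
    have h4 : (q ^ k) ^ d * ballVol d (r / 2) ≤
        (q ^ k) ^ d * (q ^ k * (K * (2 * C / r) * complVol E x r)) := by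
      rw [← h2]
      refine h1.trans ((mul_le_mul_of_nonneg_left (h3.trans
        (mul_le_mul_of_nonneg_left (hit k).2 (by positivity))) hK.le).trans_eq ?_)
      have h5 : (q ^ (d + 2)) ^ k = (q ^ k) ^ d * q ^ k * q ^ k := by
        rw [← pow_mul, ← pow_mul, ← pow_add, ← pow_add]
        ring_nf
      rw [h5]
      field_simp
    exact le_of_mul_le_mul_left h4 (by positivity)
  have hlim : Tendsto (fun k : ℕ => q ^ k * (K * (2 * C / r) * complVol E x r)) atTop (𝓝 0) := by
    simpa using (tendsto_pow_atTop_nhds_zero_of_lt_one hq.le hq1).mul_const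
      (K * (2 * C / r) * complVol E x r)
  exact (ballVol_pos d (half_pos hr0)).not_ge (ge_of_tendsto' hlim hfin)

/-- Where the perimeter measure is negligible with respect to a measure of codimension one, either
the complement has a definite volume fraction in all small balls or the point has density one. -/
theorem lowerDensity_or_mem_densitySet_one (hE : MeasurableSet E)
    (hV : variation (E.indicator fun _ => (1 : ℝ)) < ⊤) {x : Ed d} {C β r₀ : ℝ} (hβ : 0 < β)
    (hβ' : β ≤ 1 / 16) (hC : 0 < C) (hr₀ : 0 < r₀) {ν : Measure (Ed d)}
    (hν : ∀ R, 0 < R → R < r₀ → ν.real (closedBall x R) ≤ C / R * ballVol d (2 * R))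
    (hvol : ∀ τ > 0, ∀ᶠ r in 𝓝[>] (0 : ℝ),
      (varM (locallyIntegrable_indicator_one hE) hV).real (closedBall x r) ≤
        τ * ν.real (closedBall x r)) :
    x ∈ densitySet E 1 ∨ ∀ᶠ r in 𝓝[>] (0 : ℝ), ballVol d (β * r) < 2 * complVol E x r := by
  set μ := varM (locallyIntegrable_indicator_one hE) hV
  set q : ℝ := 1 / 4
  have hq : 0 < q := by norm_num [q]
  have hq1 : q < 1 := by norm_num [q]
  rw [or_iff_not_imp_right]
  intro hnot
  have hfreq : ∃ᶠ r in 𝓝[>] (0 : ℝ), 2 * complVol E x r ≤ ballVol d (β * r) := by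
    exact (Filter.not_eventually.1 hnot).mono fun r hr => not_lt.1 hr
  rw [mem_densitySet_one_iff hE]
  refine (nhdsGT_basis (0 : ℝ)).tendsto_iff (nhds_basis_Ioo_pos (0 : ℝ)) |>.2 fun ε hε => ?_
  -- `δ` bounds the volume fraction on the geometric sequence of radii.
  set δ : ℝ := min (ε * q ^ d * q ^ d / 2) ((q * β) ^ d / 2)
  have hδ : 0 < δ := by positivity
  obtain ⟨r₁, hr₁, hvol⟩ := mem_nhdsGT_iff_exists_Ioo_subset.1
    (hvol (δ / (4 * β * C)) (by positivity))
  have hr₁ : 0 < r₁ := hr₁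
  obtain ⟨r, hcon, hr⟩ := (hfreq.and_eventually (Ioo_mem_nhdsGT (lt_min hr₀ hr₁))).exists
  have hr0 : 0 < r := hr.1
  have hstep : ∀ t, 0 < t → t ≤ r → 2 * complVol E x t ≤ ballVol d (β * t) →
      complVol E x (t / 4) ≤ δ * ballVol d t := by
    intro t ht htr hm
    refine (complVol_quarter_le hE hV x hβ hβ' ht hm).trans ?_
    have h1 := hvol (show t / 2 ∈ Ioo 0 r₁ from
      ⟨half_pos ht, by linarith [hr.2.trans_le (min_le_right _ _)]⟩)
    have h2 := hν (t / 2) (half_pos ht) (by linarith [hr.2.trans_le (min_le_left _ _)])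
    rw [mul_div_cancel₀ t two_ne_zero] at h2
    calc 2 * (β * t) * μ.real (closedBall x (t / 2))
        ≤ 2 * (β * t) * (δ / (4 * β * C) * (C / (t / 2) * ballVol d t)) := by
          refine mul_le_mul_of_nonneg_left (le_trans h1 ?_) (by positivity)
          exact mul_le_mul_of_nonneg_left h2 (by positivity)
      _ = _ := by
          field_simp
          ring
  have hquart : ∀ k : ℕ, q ^ (k + 1) * r = q ^ k * r / 4 := fun k => by
    rw [pow_succ]
    simp only [q]
    ring
  have htr : ∀ k : ℕ, q ^ k * r ≤ r := fun k =>
    mul_le_of_le_one_left hr0.le (pow_le_one₀ hq.le hq1.le)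
  have hit : ∀ k : ℕ, 2 * complVol E x (q ^ k * r) ≤ ballVol d (β * (q ^ k * r)) := by
    intro k
    induction k with
    | zero => simpa using hcon
    | succ k ih =>
      have h1 := hstep (q ^ k * r) (by positivity) (htr k) ih
      have h2 : ballVol d (β * (q ^ k * r / 4)) = (q * β) ^ d * ballVol d (q ^ k * r) := by
        rw [← ballVol_mul d (by positivity) (by positivity)]
        congr 1
        simp only [q]
        ring
      rw [hquart, h2]
      have h3 : δ ≤ (q * β) ^ d / 2 := min_le_right _ _
      have h4 := ballVol_pos d (s := q ^ k * r) (by positivity)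
      nlinarith
  refine ⟨q * r, by positivity, fun t ht => ?_⟩
  have ht0 : 0 < t := ht.1
  have hb := ballVol_pos d ht0
  refine ⟨by linarith [div_nonneg (complVol_nonneg E x t) hb.le], ?_⟩
  rw [zero_add, div_lt_iff₀ hb]
  have ht1 : t / (q * r) ≤ 1 := (div_le_one (by positivity)).2 ht.2.le
  obtain ⟨k, hk1, hk2⟩ := exists_nat_pow_near_of_lt_one (by positivity) ht1 hq hq1
  rw [lt_div_iff₀ (by positivity)] at hk1
  rw [div_le_iff₀ (by positivity)] at hk2
  have h1 := hstep (q ^ k * r) (by positivity) (htr k) (hit k)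
  have h2 : t ≤ q ^ k * r / 4 := by
    rw [← hquart, pow_succ]
    linarith
  have h3 : q ^ d * q ^ d * ballVol d (q ^ k * r) ≤ ballVol d t := by
    rw [mul_assoc, ← ballVol_mul d hq.le (by positivity), ← ballVol_mul d hq.le (by positivity)]
    refine measureReal_mono (closedBall_subset_closedBall ?_) measure_closedBall_lt_top.ne
    rw [pow_succ] at hk1
    linarith
  have h4 : δ ≤ ε * q ^ d * q ^ d / 2 := min_le_left _ _
  have h5 := ballVol_pos d (s := q ^ k * r) (by positivity)
  calc complVol E x t ≤ δ * ballVol d (q ^ k * r) := (complVol_mono E x h2).trans h1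
    _ ≤ ε * q ^ d * q ^ d / 2 * ballVol d (q ^ k * r) := mul_le_mul_of_nonneg_right h4 h5.le
    _ < ε * ballVol d t := by nlinarith

end LowerDensityBounds

section HasLowerDensity

variable {d : ℕ} {E : Set (Ed d)}

/-- The complement of `E` has a definite volume fraction in all small balls around `x`. -/
def HasLowerDensity (β : ℝ) (E : Set (Ed d)) (x : Ed d) : Prop :=
  ∀ᶠ r in 𝓝[>] (0 : ℝ), ballVol d (β * r) < 2 * complVol E x r

theorem exists_ae_hasLowerDensity (d : ℕ) : ∃ β : ℝ, 0 < β ∧ ∀ (E : Set (Ed d))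
    (hE : MeasurableSet E) (hV : variation (E.indicator fun _ => (1 : ℝ)) < ⊤),
    (∀ᵐ x ∂varM (locallyIntegrable_indicator_one hE) hV, HasLowerDensity β E x) ∧
    ∀ (w : Ed d → ℝ) (hw : LocallyIntegrable w) (hVw : variation w < ⊤), (∀ x, |w x| ≤ 1) →
      ∀ᵐ x ∂varM hw hVw, x ∈ densitySet E 1 ∨ HasLowerDensity β E x := by
  obtain ⟨C, hC, hG⟩ := exists_variation_le_oscillation d
  set β : ℝ := min (1 / 16) ((1 / 4) ^ (d + 3) / C)
  have hβ : 0 < β := by positivity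
  have hβ1 : β ≤ 1 / 16 := min_le_left _ _
  have hβC : 4 * β * C ≤ (1 / 4) ^ (d + 2) := by
    have h : β * C ≤ (1 / 4) ^ (d + 3) := (le_div_iff₀ hC).1 (min_le_right _ _)
    rw [pow_succ] at h
    linarith
  refine ⟨β, hβ, fun E hE hV => ?_⟩
  set μ := varM (locallyIntegrable_indicator_one hE) hV
  have hN : ∀ᵐ x ∂μ, HasLowerDensity β E x := by
    filter_upwards [hG _ (locallyIntegrable_indicator_one hE) hV,
      Besicovitch.ae_tendsto_rnDeriv volume μ, Measure.rnDeriv_lt_top volume μ] with x h1 h2 h3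
    obtain ⟨r₀, hr₀, h1⟩ := h1
    refine lowerDensity_perimeter hE hV hβ hβ1 hβC hr₀ h1
      (K := (volume.rnDeriv μ x).toReal + 1) (by positivity)
      (eventually_real_le_mul (by positivity) ?_ h2)
    exact (ENNReal.lt_ofReal_iff_toReal_lt h3.ne).2 (lt_add_one _)
  refine ⟨hN, fun w hw hVw hw1 => ?_⟩
  set ν := varM hw hVw
  have hpos : ∀ᵐ x ∂ν, μ.rnDeriv ν x ≠ 0 → HasLowerDensity β E x :=
    (ae_withDensity_iff (Measure.measurable_rnDeriv μ ν)).1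
      (hN.filter_mono
        (Measure.absolutelyContinuous_of_le (Measure.withDensity_rnDeriv_le μ ν)).ae_le)
  filter_upwards [hpos, hG w hw hVw, Besicovitch.ae_tendsto_rnDeriv μ ν] with x h1 h2 h3
  obtain ⟨r₀, hr₀, h2⟩ := h2
  by_cases h0 : μ.rnDeriv ν x = 0
  · refine lowerDensity_or_mem_densitySet_one hE hV hβ hβ1 hC hr₀ (ν := ν) (fun R hR hR' => ?_)
      fun τ hτ => eventually_real_le_mul hτ (by rwa [h0, ENNReal.ofReal_pos]) h3
    refine (h2 R hR hR' 0).trans (mul_le_mul_of_nonneg_left ?_ (by positivity))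
    have := norm_setIntegral_le_of_norm_le_const (μ := volume) (s := closedBall x (2 * R))
      (f := fun y => |w y - 0|) (C := 1) measure_closedBall_lt_top
      fun y _ => by simpa using hw1 y
    rw [one_mul, volume_real_closedBall] at this
    exact (le_abs_self _).trans this
  · exact Or.inr (h1 h0)

theorem not_hasLowerDensity (hE : MeasurableSet E) {β : ℝ} (hβ : 0 < β) {x : Ed d}
    (hx : x ∈ densitySet E 1) : ¬ HasLowerDensity β E x := by
  intro h
  rw [mem_densitySet_one_iff hE] at hx
  obtain ⟨r, ⟨h1, h2⟩, hr⟩ := ((h.and (hx.eventually (gt_mem_nhds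
    (show (0 : ℝ) < β ^ d / 2 by positivity)))).and self_mem_nhdsWithin).exists
  have hr : 0 < r := hr
  rw [div_lt_iff₀ (ballVol_pos d hr)] at h2
  rw [ballVol_mul d hβ.le hr.le] at h1
  linarith

theorem varMeasure_indicator_densitySet_one (hE : MeasurableSet E)
    (hV : variation (E.indicator fun _ => (1 : ℝ)) < ⊤) :
    varM (locallyIntegrable_indicator_one hE) hV (densitySet E 1) = 0 := by
  obtain ⟨β, hβ, h⟩ := exists_ae_hasLowerDensity d
  exact measure_mono_null (fun x hx => not_hasLowerDensity hE hβ hx) (ae_iff.1 (h E hE hV).1)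

theorem moll_indicator_le (hE : MeasurableSet E) (n : ℕ) (x : Ed d) {β : ℝ} (hβ : 0 ≤ β)
    (h : ballVol d (β * (mollBump d n).rIn) < 2 * complVol E x (mollBump d n).rIn) :
    moll (E.indicator fun _ => (1 : ℝ)) n x ≤ 1 - (β / 2) ^ d / 2 := by
  set k := mollKernel d n
  set a := (mollBump d n).rIn
  have ha : 0 < a := (mollBump d n).rIn_pos
  have hb : (mollBump d n).rOut = 2 * a := by
    simp only [a, mollBump]
    field_simp
  have hint : Integrable fun t => k t * E.indicator (fun _ => (1 : ℝ)) (x - t) :=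
    integrable_moll_integrand (locallyIntegrable_indicator_one hE) n x
  have hcompl : ∫ t, k t * Eᶜ.indicator (fun _ => (1 : ℝ)) (x - t) =
      1 - moll (E.indicator fun _ => (1 : ℝ)) n x := by
    simp only [indicator_compl_one, mul_sub, mul_one]
    rw [integral_sub (integrable_mollKernel d n) hint, integral_mollKernel, moll_apply]
  set S := (fun t => x - t) ⁻¹' (Eᶜ ∩ closedBall x a)
  have hSm : MeasurableSet S :=
    (measurable_const.sub measurable_id) (hE.compl.inter measurableSet_closedBall)
  have hSv : volume.real S = complVol E x a := by
    rw [complVol, measureReal_def, measureReal_def]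
    congr 1
    exact (volume.measurePreserving_sub_left x).measure_preimage
      (hE.compl.inter measurableSet_closedBall).nullMeasurableSet
  have hB := ballVol_pos d ha
  have hB2 : ballVol d (2 * a) = 2 ^ d * ballVol d a := ballVol_mul d zero_le_two ha.le
  have hlow : complVol E x a * (1 / ballVol d (2 * a)) ≤
      ∫ t, k t * Eᶜ.indicator (fun _ => (1 : ℝ)) (x - t) := by
    have hfin : volume S ≠ ⊤ := by
      rw [(volume.measurePreserving_sub_left x).measure_preimage
        (hE.compl.inter measurableSet_closedBall).nullMeasurableSet]
      exact volume_inter_closedBall_ne_top _ _ _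
    rw [← hSv, ← smul_eq_mul, ← setIntegral_const, ← integral_indicator hSm]
    refine integral_mono ((integrable_indicator_iff hSm).2 (integrableOn_const hfin))
      (integrable_moll_integrand (locallyIntegrable_indicator_one hE.compl) n x) fun t => ?_
    have hk : 0 ≤ k t := mollKernel_nonneg d n t
    by_cases ht : t ∈ S
    · have htE : x - t ∈ Eᶜ := ht.1
      have hta : t ∈ closedBall (0 : Ed d) a := by
        have := ht.2
        simpa [mem_closedBall, dist_eq_norm] using this
      simp only [indicator_of_mem ht, indicator_of_mem htE, mul_one]
      have h1 : k t = 1 / ∫ y, mollBump d n y := by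
        change (mollBump d n) t / _ = _
        rw [(mollBump d n).one_of_mem_closedBall hta]
      rw [h1]
      refine one_div_le_one_div_of_le (mollBump d n).integral_pos ?_
      have h2 := (mollBump d n).integral_le_measure_closedBall (μ := volume)
      rwa [volume_real_closedBall, hb] at h2
    · simp only [indicator_of_notMem ht]
      exact mul_nonneg hk (indicator_one_nonneg _ _)
  rw [hcompl] at hlow
  rw [ballVol_mul d hβ ha.le] at h
  rw [hB2, mul_one_div] at hlow
  have h3 : (β / 2) ^ d / 2 ≤ complVol E x a / (2 ^ d * ballVol d a) := by
    rw [le_div_iff₀ (by positivity), div_pow]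
    field_simp
    linarith
  linarith

theorem tendsto_mollBump_rIn (d : ℕ) :
    Tendsto (fun n => (mollBump d n).rIn) atTop (𝓝[>] 0) := by
  refine tendsto_nhdsWithin_iff.2 ⟨?_, Eventually.of_forall fun n => (mollBump d n).rIn_pos⟩
  have h := (tendsto_one_div_add_atTop_nhds_zero_nat (𝕜 := ℝ)).const_mul (1 / 2)
  rw [mul_zero] at h
  refine h.congr fun n => ?_
  simp only [mollBump]
  field_simp

theorem HasLowerDensity.eventually_moll_le (hE : MeasurableSet E) {β : ℝ} (hβ : 0 ≤ β) {x : Ed d}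
    (h : HasLowerDensity β E x) :
    ∀ᶠ n in atTop, moll (E.indicator fun _ => (1 : ℝ)) n x ≤ 1 - (β / 2) ^ d / 2 :=
  ((tendsto_mollBump_rIn d).eventually h).mono fun n hn => moll_indicator_le hE n x hβ hn

end HasLowerDensity

section SmoothStep

/-- A smooth nondecreasing function equal to `0` on `(-∞, a]` and to `1` on `[a + ε, ∞)`. -/
def smoothStep (a ε s : ℝ) : ℝ := Real.smoothTransition ((s - a) / ε)

variable {a ε s : ℝ}

theorem contDiff_smoothStep (a ε : ℝ) : ContDiff ℝ (⊤ : ℕ∞) (smoothStep a ε) :=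
  Real.smoothTransition.contDiff.comp ((contDiff_id.sub contDiff_const).div_const ε)

theorem smoothStep_nonneg (a ε s : ℝ) : 0 ≤ smoothStep a ε s := Real.smoothTransition.nonneg _

theorem smoothStep_le_one (a ε s : ℝ) : smoothStep a ε s ≤ 1 := Real.smoothTransition.le_one _

theorem smoothStep_eq_zero (hε : 0 ≤ ε) (hs : s ≤ a) : smoothStep a ε s = 0 :=
  Real.smoothTransition.zero_of_nonpos (div_nonpos_of_nonpos_of_nonneg (by linarith) hε)

theorem smoothStep_eq_one (hε : 0 < ε) (hs : a + ε ≤ s) : smoothStep a ε s = 1 :=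
  Real.smoothTransition.one_of_one_le ((one_le_div hε).2 (by linarith))

theorem monotone_smoothStep (hε : 0 ≤ ε) : Monotone (smoothStep a ε) := fun s t h =>
  Real.smoothTransition.monotone (by gcongr)

theorem exists_deriv_smoothStep_le (a : ℝ) (hε : 0 < ε) :
    ∃ M, 2 ≤ M ∧ ∀ s, 0 ≤ deriv (smoothStep a ε) s ∧ deriv (smoothStep a ε) s ≤ M := by
  have hc : Continuous (deriv (smoothStep a ε)) :=
    (contDiff_smoothStep a ε).continuous_deriv (by simp)
  obtain ⟨M, hM⟩ := (isCompact_Icc (a := a) (b := a + ε)).exists_bound_of_continuousOn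
    hc.continuousOn
  refine ⟨max 2 M, le_max_left _ _, fun s => ⟨(monotone_smoothStep hε.le).deriv_nonneg, ?_⟩⟩
  rcases lt_or_ge s a with h | h
  · have : smoothStep a ε =ᶠ[𝓝 s] fun _ => 0 :=
      (gt_mem_nhds h).mono fun t ht => smoothStep_eq_zero hε.le ht.le
    rw [this.deriv_eq]
    simp
  rcases lt_or_ge (a + ε) s with h' | h'
  · have : smoothStep a ε =ᶠ[𝓝 s] fun _ => 1 :=
      (lt_mem_nhds h').mono fun t ht => smoothStep_eq_one hε ht.le
    rw [this.deriv_eq]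
    simp
  · exact ((le_abs_self _).trans (hM s ⟨h, h'⟩)).trans (le_max_right _ _)

end SmoothStep

section Gluing

variable {d : ℕ} {E : Set (Ed d)} {w : Ed d → ℝ} {φ₁ φ₂ φ₃ : Ed d → Ed d}

theorem pairing_mul_smooth {f : Ed d → ℝ} (hw : LocallyIntegrable w)
    (hf : ContDiff ℝ (⊤ : ℕ∞) f) (h : IsTest φ₁) :
    Integrable (fun x => w x * fderiv ℝ f x (φ₁ x)) ∧
    pairing (fun x => f x * w x) φ₁ =
      pairing w (fun x => f x • φ₁ x) - ∫ x, w x * fderiv ℝ f x (φ₁ x) := by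
  have hd : Differentiable ℝ f := hf.differentiable (by simp)
  have hcont : Continuous fun x => fderiv ℝ f x (φ₁ x) :=
    (hf.continuous_fderiv (by simp)).clm_apply h.continuous
  have hcomp : HasCompactSupport fun x => fderiv ℝ f x (φ₁ x) :=
    h.hasCompactSupport.mono fun x hx hx' => hx (by simp [hx'])
  have hint : Integrable fun x => w x * fderiv ℝ f x (φ₁ x) := by
    have := hw.integrable_smul_left_of_hasCompactSupport hcont hcomp
    simpa [mul_comm] using this
  refine ⟨hint, ?_⟩
  unfold pairing
  rw [← integral_sub ((h.smul hf).integrable_mul hw) hint]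
  refine integral_congr_ae (Eventually.of_forall fun x => ?_)
  simp only [vdiv_smul (hd x) (h.differentiable x)]
  ring

theorem pairing_one_sub (hw : LocallyIntegrable w) (h : IsTest φ₁) :
    pairing (fun x => 1 - w x) φ₁ = - pairing w φ₁ := by
  unfold pairing
  simp only [sub_mul, one_mul]
  rw [integral_sub h.integrable_vdiv (h.integrable_mul hw), integral_vdiv h, zero_sub]

theorem neg_integral_fderiv_moll_le {u : Ed d → ℝ} (hu : LocallyIntegrable u)
    (hV : variation u < ⊤) (n : ℕ) (hw : LocallyIntegrable w) (h0 : ∀ x, 0 ≤ w x)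
    (h1 : ∀ x, w x ≤ 1) (hφ₁ : IsTest φ₁) (hφ₂ : IsTest φ₂) (hφ₃ : IsTest φ₃)
    (hb₁ : ∀ x, ‖φ₁ x‖ ≤ 1) (hb₂ : ∀ x, ‖φ₂ x‖ ≤ 1) (hb₃ : ∀ x, ‖φ₃ x‖ ≤ 1) {a b : Ed d → ℝ}
    (ha : ContDiff ℝ (⊤ : ℕ∞) a) (hb : ContDiff ℝ (⊤ : ℕ∞) b) (ha0 : ∀ x, 0 ≤ a x)
    (hb0 : ∀ x, 0 ≤ b x) (hab : ∀ x, a x + b x ≤ 1) :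
    - ∫ x, fderiv ℝ (moll u n) x (a x • (w x • φ₁ x + (1 - w x) • φ₂ x) + b x • φ₃ x) ≤
      (variation u).toReal := by
  set e := moll u n
  have he : ContDiff ℝ (⊤ : ℕ∞) e := contDiff_moll hu n
  have hDint : ∀ {φ : Ed d → Ed d} {c : Ed d → ℝ}, IsTest φ → ContDiff ℝ (⊤ : ℕ∞) c →
      Integrable fun x => |c x * fderiv ℝ e x (φ x)| := fun {φ c} hφ hc =>
    ((hc.continuous.mul ((he.continuous_fderiv (by simp)).clm_apply
      hφ.continuous)).integrable_of_hasCompactSupport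
        (hφ.hasCompactSupport.mono fun x hx hx' => hx (by simp [hx']))).abs
  have hw01 : ∀ m x, 0 ≤ moll w m x ∧ moll w m x ≤ 1 := fun m x =>
    ⟨moll_nonneg h0 m x, moll_le_one hw h1 m x⟩
  set Ψ : ℕ → Ed d → Ed d := fun m x =>
    a x • (moll w m x • φ₁ x + (1 - moll w m x) • φ₂ x) + b x • φ₃ x
  have hΨ : ∀ m, IsTest (Ψ m) := fun m =>
    (((hφ₁.smul (contDiff_moll hw m)).add
      (hφ₂.smul (contDiff_const.sub (contDiff_moll hw m)))).smul ha).add (hφ₃.smul hb)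
  have hΨ1 : ∀ m x, ‖Ψ m x‖ ≤ 1 := by
    intro m x
    obtain ⟨hw0, hw1⟩ := hw01 m x
    have hin : ‖moll w m x • φ₁ x + (1 - moll w m x) • φ₂ x‖ ≤ 1 := by
      refine (norm_add_le _ _).trans ?_
      rw [norm_smul, norm_smul, Real.norm_of_nonneg hw0, Real.norm_of_nonneg (sub_nonneg.2 hw1)]
      nlinarith [mul_le_mul_of_nonneg_left (hb₁ x) hw0,
        mul_le_mul_of_nonneg_left (hb₂ x) (sub_nonneg.2 hw1)]
    refine (norm_add_le _ _).trans ?_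
    rw [norm_smul, norm_smul, Real.norm_of_nonneg (ha0 x), Real.norm_of_nonneg (hb0 x)]
    nlinarith [mul_le_mul_of_nonneg_left hin (ha0 x), mul_le_mul_of_nonneg_left (hb₃ x) (hb0 x),
      hab x]
  have hle : ∀ m, - ∫ x, fderiv ℝ e x (Ψ m x) ≤ (variation u).toReal := fun m => by
    rw [← pairing_smooth he (hΨ m)]
    simpa using pairing_moll_le_variation hu hV (hΨ m) n zero_le_one (hΨ1 m)
  suffices h : Tendsto (fun m => ∫ x, fderiv ℝ e x (Ψ m x)) atTop
      (𝓝 (∫ x, fderiv ℝ e x (a x • (w x • φ₁ x + (1 - w x) • φ₂ x) + b x • φ₃ x))) from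
    le_of_tendsto' h.neg hle
  refine tendsto_integral_of_dominated_convergence
    (fun x => |a x * fderiv ℝ e x (φ₁ x)| + |a x * fderiv ℝ e x (φ₂ x)| +
      |b x * fderiv ℝ e x (φ₃ x)|)
    (fun m => ((he.continuous_fderiv (by simp)).clm_apply
      (hΨ m).continuous).aestronglyMeasurable)
    (((hDint hφ₁ ha).add (hDint hφ₂ ha)).add (hDint hφ₃ hb))
    (fun m => Eventually.of_forall fun x => ?_) ?_
  · obtain ⟨hw0, hw1⟩ := hw01 m x
    simp only [Ψ, map_add, map_smul, smul_eq_mul, Real.norm_eq_abs]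
    refine (abs_add_le _ _).trans (add_le_add_left ?_ _)
    rw [mul_add, mul_left_comm, mul_left_comm (a x)]
    refine (abs_add_le _ _).trans (add_le_add ?_ ?_)
    · rw [abs_mul, abs_of_nonneg hw0]
      exact mul_le_of_le_one_left (abs_nonneg _) hw1
    · rw [abs_mul, abs_of_nonneg (sub_nonneg.2 hw1)]
      exact mul_le_of_le_one_left (abs_nonneg _) (by linarith)
  · filter_upwards [tendsto_moll hw] with x hx
    have hcont : Continuous fun t : ℝ =>
        fderiv ℝ e x (a x • (t • φ₁ x + (1 - t) • φ₂ x) + b x • φ₃ x) := by fun_prop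
    exact (hcont.tendsto (w x)).comp hx


theorem locallyIntegrable_one_sub (hw : LocallyIntegrable w) :
    LocallyIntegrable fun x => 1 - w x :=
  (locallyIntegrable_const 1).sub hw

/-- The inequality behind the gluing of test fields, at the level of mollifications. -/
theorem pairing_smoothStep_moll_le {u : Ed d → ℝ} (hu : LocallyIntegrable u)
    (hV : variation u < ⊤) (n : ℕ) (hw : LocallyIntegrable w) (h0 : ∀ x, 0 ≤ w x)
    (h1 : ∀ x, w x ≤ 1) (hφ₁ : IsTest φ₁) (hφ₂ : IsTest φ₂) (hφ₃ : IsTest φ₃)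
    (hb₁ : ∀ x, ‖φ₁ x‖ ≤ 1) (hb₂ : ∀ x, ‖φ₂ x‖ ≤ 1) (hb₃ : ∀ x, ‖φ₃ x‖ ≤ 1) {χ : ℝ → ℝ}
    (hχ : ContDiff ℝ (⊤ : ℕ∞) χ) {M : ℝ} (hM : 0 < M)
    (hχM : ∀ s, 0 ≤ deriv χ s ∧ deriv χ s ≤ M) :
    M⁻¹ * (pairing (fun x => χ (moll u n x) * w x) φ₁ +
        pairing (fun x => χ (moll u n x) * (1 - w x)) φ₂ -
        pairing w (fun x => χ (moll u n x) • (φ₁ x - φ₂ x))) +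
      pairing (fun x => moll u n x - M⁻¹ * χ (moll u n x)) φ₃ ≤ (variation u).toReal := by
  set e := moll u n
  have he : ContDiff ℝ (⊤ : ℕ∞) e := contDiff_moll hu n
  have hχ' : ContDiff ℝ (⊤ : ℕ∞) (deriv χ) := (contDiff_infty_iff_deriv.1 hχ).2
  set f : Ed d → ℝ := fun x => χ (e x)
  have hf : ContDiff ℝ (⊤ : ℕ∞) f := hχ.comp he
  have hfd : ∀ x v, fderiv ℝ f x v = deriv χ (e x) * fderiv ℝ e x v := fun x v => by
    have h : fderiv ℝ f x = _ := ((hχ.differentiable (by simp) (e x)).hasDerivAt.comp_hasFDerivAt x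
      (he.differentiable (by simp) x).hasFDerivAt).fderiv
    rw [h]
    rfl
  have ha : ContDiff ℝ (⊤ : ℕ∞) fun x => M⁻¹ * deriv χ (e x) := contDiff_const.mul (hχ'.comp he)
  have hc0 : ∀ x, 0 ≤ M⁻¹ * deriv χ (e x) := fun x => mul_nonneg (inv_nonneg.2 hM.le) (hχM _).1
  have hc1 : ∀ x, M⁻¹ * deriv χ (e x) ≤ 1 := fun x => by
    rw [inv_mul_le_iff₀ hM, mul_one]
    exact (hχM _).2
  have hmain := neg_integral_fderiv_moll_le hu hV n hw h0 h1 hφ₁ hφ₂ hφ₃ hb₁ hb₂ hb₃ ha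
    (contDiff_const.sub ha) hc0 (fun x => sub_nonneg.2 (hc1 x)) (fun x => (by ring_nf; rfl))
  refine le_trans (le_of_eq ?_) hmain
  obtain ⟨hi₁, hp₁⟩ := pairing_mul_smooth hw hf hφ₁
  obtain ⟨hi₂, hp₂⟩ := pairing_mul_smooth (locallyIntegrable_one_sub hw) hf hφ₂
  have hg : ContDiff ℝ (⊤ : ℕ∞) fun s => s - M⁻¹ * χ s := contDiff_id.sub (contDiff_const.mul hχ)
  have hgd : ∀ s, deriv (fun s => s - M⁻¹ * χ s) s = 1 - M⁻¹ * deriv χ s := fun s =>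
    ((hasDerivAt_id s).sub ((hχ.differentiable (by simp) s).hasDerivAt.const_mul M⁻¹)).deriv
  have hp₃ := pairing_comp_smooth (g := fun s => s - M⁻¹ * χ s) he hg hφ₃
  simp only [hgd] at hp₃
  have hψ : IsTest fun x => (1 - M⁻¹ * deriv χ (e x)) • φ₃ x := hφ₃.smul (contDiff_const.sub ha)
  have hi₃ : Integrable fun x => fderiv ℝ e x ((1 - M⁻¹ * deriv χ (e x)) • φ₃ x) :=
    ((he.continuous_fderiv (by simp)).clm_apply hψ.continuous).integrable_of_hasCompactSupport
        (hψ.hasCompactSupport.mono fun x hx hx' =>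
          hx ((congrArg (fderiv ℝ e x) hx').trans (map_zero _)))
  rw [pairing_smooth he hψ] at hp₃
  have hsub : pairing w (fun x => f x • (φ₁ x - φ₂ x)) =
      pairing w (fun x => f x • φ₁ x) - pairing w (fun x => f x • φ₂ x) := by
    have := pairing_add hw (hφ₁.smul hf) ((hφ₂.smul hf).const_smul (-1))
    rw [pairing_const_smul _ (hφ₂.smul hf)] at this
    simp only [neg_one_smul, ← sub_eq_add_neg, ← smul_sub] at this
    rw [this]
    ring
  rw [pairing_one_sub hw (hφ₂.smul hf)] at hp₂
  rw [hsub, hp₁, hp₂, hp₃]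
  have hi₁₂ : Integrable fun x => M⁻¹ * (w x * fderiv ℝ f x (φ₁ x)) +
      M⁻¹ * ((1 - w x) * fderiv ℝ f x (φ₂ x)) := (hi₁.const_mul _).add (hi₂.const_mul _)
  have hsplit : ∫ x, fderiv ℝ e x ((M⁻¹ * deriv χ (e x)) • (w x • φ₁ x + (1 - w x) • φ₂ x) +
      (1 - M⁻¹ * deriv χ (e x)) • φ₃ x) =
      M⁻¹ * (∫ x, w x * fderiv ℝ f x (φ₁ x)) + M⁻¹ * (∫ x, (1 - w x) * fderiv ℝ f x (φ₂ x)) +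
        ∫ x, fderiv ℝ e x ((1 - M⁻¹ * deriv χ (e x)) • φ₃ x) := by
    rw [← integral_const_mul, ← integral_const_mul,
      ← integral_add (hi₁.const_mul _) (hi₂.const_mul _), ← integral_add hi₁₂ hi₃]
    refine integral_congr_ae (Eventually.of_forall fun x => ?_)
    simp only [hfd, map_add, map_smul, smul_eq_mul]
    ring
  rw [hsplit]
  ring

/-- If the gradient of `w` does not charge the points of density one of `E`, test fields on the
two pieces of `E` weighted by `w` and `1 - w` can be glued. -/
theorem pairing_add_pairing_le_perimeter (hE : MeasurableSet E)
    (hV : variation (E.indicator fun _ => (1 : ℝ)) < ⊤) (hw : LocallyIntegrable w)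
    (hVw : variation w < ⊤) (h0 : ∀ x, 0 ≤ w x) (h1 : ∀ x, w x ≤ 1)
    (hz : varM hw hVw (densitySet E 1) = 0) (hφ₁ : IsTest φ₁) (hφ₂ : IsTest φ₂)
    (hb₁ : ∀ x, ‖φ₁ x‖ ≤ 1) (hb₂ : ∀ x, ‖φ₂ x‖ ≤ 1) :
    pairing (fun x => E.indicator (fun _ => (1 : ℝ)) x * w x) φ₁ +
      pairing (fun x => E.indicator (fun _ => (1 : ℝ)) x * (1 - w x)) φ₂ ≤
        (variation (E.indicator fun _ => (1 : ℝ))).toReal := by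
  obtain ⟨β, hβ, hLD⟩ := exists_ae_hasLowerDensity d
  set u : Ed d → ℝ := E.indicator fun _ => (1 : ℝ)
  have hu : LocallyIntegrable u := locallyIntegrable_indicator_one hE
  set ν := varM hw hVw
  set δ : ℝ := min ((β / 2) ^ d / 2) 1
  have hδ : 0 < δ := by positivity
  have hδ1 : δ ≤ 1 := min_le_right _ _
  set χ := smoothStep (1 - δ) δ
  have hχ : ContDiff ℝ (⊤ : ℕ∞) χ := contDiff_smoothStep _ _
  have hχ01 : ∀ s, |χ s| ≤ 1 := fun s => by
    rw [abs_of_nonneg (smoothStep_nonneg _ _ _)]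
    exact smoothStep_le_one _ _ _
  have hχ0 : χ 0 = 0 := smoothStep_eq_zero hδ.le (by linarith)
  have hχ1 : χ 1 = 1 := smoothStep_eq_one hδ (by linarith)
  have hχu : ∀ x, χ (u x) = u x := fun x => by
    by_cases hx : x ∈ E <;> simp [u, hx, hχ0, hχ1]
  obtain ⟨M, hM2, hχM⟩ := exists_deriv_smoothStep_le (1 - δ) hδ
  have hM : 0 < M := by linarith
  have hMinv : M⁻¹ ≤ 1 / 2 := by
    rw [one_div]
    exact inv_anti₀ two_pos hM2
  have hMinv0 : 0 < M⁻¹ := inv_pos.2 hM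
  set e := moll u
  have hec : ∀ n, ContDiff ℝ (⊤ : ℕ∞) (e n) := contDiff_moll hu
  have hemeas : ∀ n, AEStronglyMeasurable (fun x => χ (e n x)) volume := fun n =>
    (hχ.comp (hec n)).continuous.aestronglyMeasurable
  have hlim : ∀ᵐ x, Tendsto (fun n => χ (e n x)) atTop (𝓝 (u x)) := by
    filter_upwards [tendsto_moll hu] with x hx
    rw [← hχu x]
    exact (hχ.continuous.tendsto _).comp hx
  have hν : ∀ᵐ x ∂ν, ∀ᶠ n in atTop, χ (e n x) = 0 := by
    filter_upwards [(hLD E hE hV).2 w hw hVw fun x => abs_le.2 ⟨by linarith [h0 x], h1 x⟩,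
      measure_eq_zero_iff_ae_notMem.1 hz] with x hx hx'
    filter_upwards [(hx.resolve_left hx').eventually_moll_le hE hβ.le] with n hn
    exact smoothStep_eq_zero hδ.le (hn.trans (by linarith [min_le_left ((β / 2) ^ d / 2) 1]))
  have hψ : IsTest fun x => φ₁ x - φ₂ x := hφ₁.sub hφ₂
  have herr : Tendsto (fun n => pairing w (fun x => χ (e n x) • (φ₁ x - φ₂ x))) atTop (𝓝 0) := by
    have hT : Tendsto (fun n => ∫ x, ‖χ (e n x) • (φ₁ x - φ₂ x)‖ ∂ν) atTop (𝓝 0) := by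
      rw [← integral_zero (Ed d) ℝ (μ := ν)]
      refine tendsto_integral_of_dominated_convergence (fun _ => 2) (fun n =>
        (hψ.smul (hχ.comp (hec n))).continuous.norm.aestronglyMeasurable) (integrable_const _)
        (fun n => Eventually.of_forall fun x => ?_) ?_
      · rw [norm_norm, norm_smul]
        have := (norm_sub_le (φ₁ x) (φ₂ x)).trans (add_le_add (hb₁ x) (hb₂ x))
        nlinarith [hχ01 (e n x), norm_nonneg (φ₁ x - φ₂ x), Real.norm_eq_abs (χ (e n x)),
          abs_nonneg (χ (e n x))]
      · filter_upwards [hν] with x hx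
        refine tendsto_const_nhds.congr' ?_
        filter_upwards [hx] with n hn
        simp [hn]
    exact squeeze_zero_norm (fun n =>
      abs_pairing_le_integral hw hVw (hψ.smul (hχ.comp (hec n))))
      (by simpa using hT.const_mul 2)
  set X := pairing (fun x => u x * w x) φ₁ + pairing (fun x => u x * (1 - w x)) φ₂
  have hwabs : ∀ x, |w x| ≤ 1 ∧ |1 - w x| ≤ 1 := fun x =>
    ⟨abs_le.2 ⟨by linarith [h0 x], h1 x⟩, abs_le.2 ⟨by linarith [h1 x], by linarith [h0 x]⟩⟩
  have hX : Tendsto (fun n => pairing (fun x => χ (e n x) * w x) φ₁ +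
      pairing (fun x => χ (e n x) * (1 - w x)) φ₂) atTop (𝓝 X) := by
    refine Tendsto.add ?_ ?_
    · refine tendsto_pairing (v := fun n x => χ (e n x) * w x) (C := 1)
        (fun n => (hemeas n).mul hw.aestronglyMeasurable)
        (fun n x => ?_) (hlim.mono fun x hx => hx.mul_const _) hφ₁
      rw [abs_mul]
      exact mul_le_one₀ (hχ01 _) (abs_nonneg _) (hwabs x).1
    · refine tendsto_pairing (v := fun n x => χ (e n x) * (1 - w x)) (C := 1)
        (fun n => (hemeas n).mul
        (aestronglyMeasurable_const.sub hw.aestronglyMeasurable))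
        (fun n x => ?_) (hlim.mono fun x hx => hx.mul_const _) hφ₂
      rw [abs_mul]
      exact mul_le_one₀ (hχ01 _) (abs_nonneg _) (hwabs x).2
  have hkey : ∀ φ₃, IsTest φ₃ → (∀ x, ‖φ₃ x‖ ≤ 1) →
      M⁻¹ * X + (1 - M⁻¹) * pairing u φ₃ ≤ (variation u).toReal := by
    intro φ₃ hφ₃ hb₃
    have hY : Tendsto (fun n => pairing (fun x => e n x - M⁻¹ * χ (e n x)) φ₃) atTop
        (𝓝 (pairing (fun x => (1 - M⁻¹) * u x) φ₃)) := by
      refine tendsto_pairing (v := fun n x => e n x - M⁻¹ * χ (e n x)) (C := 2)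
        (fun n => (hec n).continuous.aestronglyMeasurable.sub
        ((hemeas n).const_mul _)) (fun n x => ?_) ?_ hφ₃
      · have h2 : 0 ≤ e n x := moll_nonneg (indicator_one_nonneg E) n x
        have h3 : e n x ≤ 1 := moll_le_one hu (indicator_one_le_one E) n x
        have h4 := abs_le.1 (hχ01 (e n x))
        refine abs_le.2 ⟨by nlinarith, by nlinarith⟩
      · filter_upwards [hlim, tendsto_moll hu] with x hx hx'
        convert hx'.sub (hx.const_mul M⁻¹) using 2
        ring
    have hconst : pairing (fun x => (1 - M⁻¹) * u x) φ₃ = (1 - M⁻¹) * pairing u φ₃ := by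
      unfold pairing
      rw [← integral_const_mul]
      simp only [mul_assoc]
    rw [hconst] at hY
    have hall := (((hX.sub herr).const_mul M⁻¹).add hY)
    rw [sub_zero] at hall
    exact le_of_tendsto' hall fun n => pairing_smoothStep_moll_le hu hV n hw h0 h1 hφ₁ hφ₂ hφ₃
      hb₁ hb₂ hb₃ hχ hM hχM
  set P := (variation u).toReal
  have hM1 : 0 < 1 - M⁻¹ := by linarith
  have hP : P ≤ (P - M⁻¹ * X) / (1 - M⁻¹) := by
    refine ENNReal.toReal_le_of_le_ofReal (div_nonneg ?_ hM1.le) (variationOn_le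
      fun φ₃ hφ₃ _ hb₃ => ENNReal.ofReal_le_ofReal ?_)
    · have := hkey (fun _ => 0) ⟨contDiff_const, HasCompactSupport.zero⟩ (by simp)
      rw [pairing_zero] at this
      linarith
    · rw [le_div_iff₀ hM1]
      linarith [hkey φ₃ hφ₃ hb₃]
  rw [le_div_iff₀ hM1] at hP
  have : M⁻¹ * X ≤ M⁻¹ * P := by linarith
  exact le_of_mul_le_mul_left this hMinv0

end Gluing

section Subadditivity

variable {d : ℕ} {u v : Ed d → ℝ}

theorem pairing_fun_add (hu : LocallyIntegrable u) (hv : LocallyIntegrable v) {φ : Ed d → Ed d}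
    (hφ : IsTest φ) : pairing (fun x => u x + v x) φ = pairing u φ + pairing v φ := by
  rw [pairing, pairing, pairing, ← integral_add (hφ.integrable_mul hu) (hφ.integrable_mul hv)]
  simp_rw [add_mul]

theorem variationOn_fun_add_le (hu : LocallyIntegrable u) (hv : LocallyIntegrable v)
    (Ω : Set (Ed d)) :
    variationOn (fun x => u x + v x) Ω ≤ variationOn u Ω + variationOn v Ω := by
  refine variationOn_le fun φ hφ hs h1 => ?_
  rw [pairing_fun_add hu hv hφ]
  exact ENNReal.ofReal_add_le.trans
    (add_le_add (ofReal_pairing_le u hφ hs h1) (ofReal_pairing_le v hφ hs h1))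

theorem variation_add_variation_le {M : ℝ≥0∞} (hM : M ≠ ⊤)
    (H : ∀ φ₁ φ₂ : Ed d → Ed d, IsTest φ₁ → IsTest φ₂ → (∀ x, ‖φ₁ x‖ ≤ 1) → (∀ x, ‖φ₂ x‖ ≤ 1) →
      pairing u φ₁ + pairing v φ₂ ≤ M.toReal) :
    variation u + variation v ≤ M := by
  have h0 : IsTest fun _ : Ed d => (0 : Ed d) := ⟨contDiff_const, HasCompactSupport.zero⟩
  have hne : Nonempty {φ : Ed d → Ed d // ContDiff ℝ (⊤ : ℕ∞) φ ∧
      HasCompactSupport φ ∧ tsupport φ ⊆ univ ∧ ∀ x, ‖φ x‖ ≤ 1} :=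
    ⟨⟨fun _ => 0, contDiff_const, HasCompactSupport.zero, by simp, by simp⟩⟩
  have key : ∀ φ₁ φ₂ : Ed d → Ed d, IsTest φ₁ → IsTest φ₂ → (∀ x, ‖φ₁ x‖ ≤ 1) →
      (∀ x, ‖φ₂ x‖ ≤ 1) → ENNReal.ofReal (pairing u φ₁) + ENNReal.ofReal (pairing v φ₂) ≤ M := by
    intro φ₁ φ₂ h₁ h₂ b₁ b₂
    rw [← ENNReal.ofReal_toReal hM]
    rcases le_total 0 (pairing u φ₁) with hp | hp
    · rcases le_total 0 (pairing v φ₂) with hq | hq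
      · rw [← ENNReal.ofReal_add hp hq]
        exact ENNReal.ofReal_le_ofReal (H φ₁ φ₂ h₁ h₂ b₁ b₂)
      · rw [ENNReal.ofReal_of_nonpos hq, add_zero]
        refine ENNReal.ofReal_le_ofReal ?_
        simpa [pairing_zero] using H φ₁ _ h₁ h0 b₁ (by simp)
    · rw [ENNReal.ofReal_of_nonpos hp, zero_add]
      refine ENNReal.ofReal_le_ofReal ?_
      simpa [pairing_zero] using H _ φ₂ h0 h₂ (by simp) b₂
  rw [variation, variation, variationOn, variationOn]
  refine ENNReal.iSup_add_iSup_le ?_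
  rintro ⟨φ, h1, h2, h3, h4⟩ ⟨ψ, k1, k2, k3, k4⟩
  simp only [setIntegral_mul_vdiv u h3, setIntegral_mul_vdiv v k3]
  exact key φ ψ ⟨h1, h2⟩ ⟨k1, k2⟩ h4 k4

theorem indicator_one_union_of_disjoint {A B : Set (Ed d)} (h : Disjoint A B) :
    ((A ∪ B).indicator fun _ => (1 : ℝ)) =
      fun x => A.indicator (fun _ => (1 : ℝ)) x + B.indicator (fun _ => (1 : ℝ)) x :=
  indicator_union_of_disjoint h _

theorem variationOn_indicator_union_le {A B : Set (Ed d)} (hA : MeasurableSet A)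
    (hB : MeasurableSet B) (h : Disjoint A B) (Ω : Set (Ed d)) :
    variationOn ((A ∪ B).indicator fun _ => (1 : ℝ)) Ω ≤
      variationOn (A.indicator fun _ => (1 : ℝ)) Ω +
        variationOn (B.indicator fun _ => (1 : ℝ)) Ω := by
  rw [indicator_one_union_of_disjoint h]
  exact variationOn_fun_add_le (locallyIntegrable_indicator_one hA)
    (locallyIntegrable_indicator_one hB) Ω

theorem varMeasure_le_mul_of_variationOn_le {c : ℝ≥0∞} (hc0 : c ≠ 0) (hc : c ≠ ⊤)
    (h : ∀ Ω, IsOpen Ω → variationOn v Ω ≤ c * variationOn u Ω) (s : Set (Ed d)) :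
    varMeasure v s ≤ c * varMeasure u s := by
  simp only [varMeasure, ENNReal.mul_iInf_of_ne hc0 hc]
  exact iInf_mono fun Ω => iInf_mono fun hΩ => iInf_mono fun _ => h Ω hΩ

theorem varMeasure_congr_ae (h : u =ᵐ[volume] v) (s : Set (Ed d)) :
    varMeasure u s = varMeasure v s := by
  simp only [varMeasure, variationOn_congr_ae h]

end Subadditivity

section Superlevel

variable {d : ℕ} {u : Ed d → ℝ} {E : Set (Ed d)}

theorem indicator_one_mul_indicator_one (A B : Set (Ed d)) (x : Ed d) :
    A.indicator (fun _ => (1 : ℝ)) x * B.indicator (fun _ => (1 : ℝ)) x =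
      (A ∩ B).indicator (fun _ => (1 : ℝ)) x := by
  classical
  by_cases hA : x ∈ A <;> by_cases hB : x ∈ B <;> simp [hA, hB]

theorem indicator_one_mul_one_sub_indicator_one (A B : Set (Ed d)) (x : Ed d) :
    A.indicator (fun _ => (1 : ℝ)) x * (1 - B.indicator (fun _ => (1 : ℝ)) x) =
      (A \ B).indicator (fun _ => (1 : ℝ)) x := by
  classical
  by_cases hA : x ∈ A <;> by_cases hB : x ∈ B <;> simp [hA, hB]

theorem tendsto_smoothStep_indicator (t s : ℝ) :
    Tendsto (fun k : ℕ => smoothStep t (1 / ((k : ℝ) + 1)) s) atTop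
      (𝓝 ((Ioi t).indicator (fun _ => (1 : ℝ)) s)) := by
  by_cases hs : t < s
  · rw [indicator_of_mem (mem_Ioi.2 hs)]
    refine tendsto_const_nhds.congr' ?_
    have := (tendsto_one_div_add_atTop_nhds_zero_nat (𝕜 := ℝ)).eventually_lt_const (sub_pos.2 hs)
    filter_upwards [this] with k hk
    exact (smoothStep_eq_one (by positivity) (by linarith)).symm
  · rw [indicator_of_notMem (by simpa using hs)]
    refine tendsto_const_nhds.congr fun k => ?_
    exact (smoothStep_eq_zero (by positivity) (not_lt.1 hs)).symm

theorem varMeasure_smoothStep_comp_eq_zero (hu : LocallyIntegrable u) (hV : variation u < ⊤)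
    (t : ℝ) {ε : ℝ} (hε : 0 < ε) {s : Set (Ed d)} (hz : varMeasure u s = 0) :
    variation (fun x => smoothStep t ε (u x)) < ⊤ ∧
      varMeasure (fun x => smoothStep t ε (u x)) s = 0 := by
  obtain ⟨M, hM, hd⟩ := exists_deriv_smoothStep_le t hε
  have h : ∀ Ω, IsOpen Ω → variationOn (fun x => smoothStep t ε (u x)) Ω ≤
      ENNReal.ofReal M * variationOn u Ω := fun Ω hΩ =>
    variationOn_comp_le hu (contDiff_smoothStep t ε)
      (fun s => abs_le.2 ⟨by linarith [smoothStep_nonneg t ε s], smoothStep_le_one t ε s⟩)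
      (fun s => abs_le.2 ⟨by linarith [(hd s).1], (hd s).2⟩) hΩ (variationOn_lt_top hV)
  refine ⟨(h univ isOpen_univ).trans_lt (ENNReal.mul_lt_top ENNReal.ofReal_lt_top hV), ?_⟩
  refine le_antisymm ((varMeasure_le_mul_of_variationOn_le
    (ENNReal.ofReal_pos.2 (by linarith)).ne' ENNReal.ofReal_ne_top h s).trans ?_) bot_le
  rw [hz, mul_zero]

theorem perimeter_superlevel_add_le (hE : MeasurableSet E) (hP : perimeter E < ⊤)
    (hu : LocallyIntegrable u) (hm : Measurable u) (hV : variation u < ⊤)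
    (hz : varMeasure u (densitySet E 1) = 0) (t : ℝ) :
    perimeter (E ∩ u ⁻¹' Ioi t) + perimeter (E \ u ⁻¹' Ioi t) ≤ perimeter E := by
  refine variation_add_variation_le hP.ne fun φ₁ φ₂ h₁ h₂ b₁ b₂ => ?_
  set w : ℕ → Ed d → ℝ := fun k x => smoothStep t (1 / ((k : ℝ) + 1)) (u x) with hw
  have w0 : ∀ k x, 0 ≤ w k x := fun k x => smoothStep_nonneg _ _ _
  have w1 : ∀ k x, w k x ≤ 1 := fun k x => smoothStep_le_one _ _ _
  have wm : ∀ k, Measurable (w k) := fun k =>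
    (contDiff_smoothStep _ _).continuous.measurable.comp hm
  have wli : ∀ k, LocallyIntegrable (w k) := fun k =>
    (locallyIntegrable_const (1 : ℝ)).mono (wm k).aestronglyMeasurable
      (Eventually.of_forall fun x => by
        rw [Real.norm_of_nonneg (w0 k x), norm_one]; exact w1 k x)
  have hwz := fun k : ℕ => varMeasure_smoothStep_comp_eq_zero hu hV t
    (ε := 1 / ((k : ℝ) + 1)) (by positivity) hz
  have im : Measurable (E.indicator fun _ => (1 : ℝ)) := measurable_const.indicator hE
  have hlim : ∀ x, Tendsto (fun k => w k x) atTop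
      (𝓝 ((u ⁻¹' Ioi t).indicator (fun _ => (1 : ℝ)) x)) := fun x =>
    tendsto_smoothStep_indicator t (u x)
  have i0 := indicator_one_nonneg E
  have i1 := indicator_one_le_one E
  have T₁ : Tendsto (fun k => pairing (fun x => E.indicator (fun _ => (1 : ℝ)) x * w k x) φ₁)
      atTop (𝓝 (pairing ((E ∩ u ⁻¹' Ioi t).indicator fun _ => (1 : ℝ)) φ₁)) := by
    refine tendsto_pairing (v := fun k x => E.indicator (fun _ => (1 : ℝ)) x * w k x) (C := 1)
      (fun k => (im.mul (wm k)).aestronglyMeasurable)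
      (fun k x => ?_) (Eventually.of_forall fun x => ?_) h₁
    · rw [abs_of_nonneg (mul_nonneg (i0 x) (w0 k x))]
      exact mul_le_one₀ (i1 x) (w0 k x) (w1 k x)
    · rw [← indicator_one_mul_indicator_one]
      exact (hlim x).const_mul _
  have T₂ : Tendsto (fun k => pairing (fun x => E.indicator (fun _ => (1 : ℝ)) x * (1 - w k x)) φ₂)
      atTop (𝓝 (pairing ((E \ u ⁻¹' Ioi t).indicator fun _ => (1 : ℝ)) φ₂)) := by
    refine tendsto_pairing (v := fun k x => E.indicator (fun _ => (1 : ℝ)) x * (1 - w k x)) (C := 1)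
      (fun k => (im.mul (measurable_const.sub (wm k))).aestronglyMeasurable)
      (fun k x => ?_) (Eventually.of_forall fun x => ?_) h₂
    · have := w0 k x
      have := w1 k x
      rw [abs_of_nonneg (mul_nonneg (i0 x) (by linarith))]
      exact mul_le_one₀ (i1 x) (by linarith) (by linarith)
    · rw [← indicator_one_mul_one_sub_indicator_one]
      exact ((hlim x).const_sub 1).const_mul _
  refine le_of_tendsto (T₁.add T₂) (Eventually.of_forall fun k => ?_)
  refine pairing_add_pairing_le_perimeter hE hP (wli k) (hwz k).1 (w0 k) (w1 k) ?_ h₁ h₂ b₁ b₂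
  exact le_antisymm ((varM_le_varMeasure _ _ _).trans (hwz k).2.le) bot_le

theorem Indecomposable.exists_ae_eq_const (hE : MeasurableSet E) (hP : perimeter E < ⊤)
    (hI : Indecomposable E) (hu : LocallyIntegrable u) (hV : variation u < ⊤)
    (hz : varMeasure u (densitySet E 1) = 0) :
    ∃ c : ℝ, ∀ᵐ x ∂(volume.restrict E), u x = c := by
  wlog hm : Measurable u generalizing u
  · have hae := hu.aestronglyMeasurable.ae_eq_mk
    set v := hu.aestronglyMeasurable.mk u
    obtain ⟨c, hc⟩ := this (u := v) (hu.congr hae)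
      (by rwa [variation, ← variationOn_congr_ae hae])
      (by rwa [← varMeasure_congr_ae hae])
      hu.aestronglyMeasurable.stronglyMeasurable_mk.measurable
    refine ⟨c, ?_⟩
    filter_upwards [hc, ae_restrict_of_ae hae] with x hx hx' using hx'.trans hx
  refine Filter.exists_eventuallyEq_const_of_forall_separating (p := (· ∈ range (Ioi : ℝ → Set ℝ)))
    ?_
  rintro _ ⟨t, rfl⟩
  have mA : MeasurableSet (E ∩ u ⁻¹' Ioi t) := hE.inter (hm measurableSet_Ioi)
  have mB : MeasurableSet (E \ u ⁻¹' Ioi t) := hE.diff (hm measurableSet_Ioi)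
  have hd : Disjoint (E ∩ u ⁻¹' Ioi t) (E \ u ⁻¹' Ioi t) :=
    disjoint_sdiff_right.mono_left inter_subset_right
  have hun : E = E ∩ u ⁻¹' Ioi t ∪ E \ u ⁻¹' Ioi t := (inter_union_sdiff _ _).symm
  by_contra! hcon
  refine hI ⟨_, _, mA, mB, hun, hd.inter_eq, ?_, ?_, le_antisymm ?_
    (perimeter_superlevel_add_le hE hP hu hm hV hz t)⟩
  · refine pos_iff_ne_zero.2 fun h0 => hcon.2 ?_
    rw [ae_restrict_iff' hE]
    filter_upwards [measure_eq_zero_iff_ae_notMem.1 h0] with x hx hxE hxt using hx ⟨hxE, hxt⟩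
  · refine pos_iff_ne_zero.2 fun h0 => hcon.1 ?_
    rw [ae_restrict_iff' hE]
    filter_upwards [measure_eq_zero_iff_ae_notMem.1 h0] with x hx hxE
    by_contra hxt
    exact hx ⟨hxE, hxt⟩
  · have := variationOn_indicator_union_le mA mB hd univ
    rwa [← hun] at this

end Superlevel

section Additivity

variable {d : ℕ} {A B E : Set (Ed d)}

theorem varM_union_le (hA : MeasurableSet A) (hB : MeasurableSet B) (hd : Disjoint A B)
    (hV : variation ((A ∪ B).indicator fun _ => (1 : ℝ)) < ⊤)
    (hVA : variation (A.indicator fun _ => (1 : ℝ)) < ⊤)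
    (hVB : variation (B.indicator fun _ => (1 : ℝ)) < ⊤) :
    varM (locallyIntegrable_indicator_one (hA.union hB)) hV ≤
      varM (locallyIntegrable_indicator_one hA) hVA +
        varM (locallyIntegrable_indicator_one hB) hVB := by
  refine Measure.le_intro fun s _ _ => ?_
  rw [Set.measure_eq_iInf_isOpen s (varM (locallyIntegrable_indicator_one hA) hVA +
        varM (locallyIntegrable_indicator_one hB) hVB)]
  refine le_iInf fun Ω => le_iInf fun hs => le_iInf fun hΩ => (measure_mono hs).trans ?_
  rw [Measure.add_apply, varM_open _ _ hΩ, varM_open _ _ hΩ, varM_open _ _ hΩ]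
  exact variationOn_indicator_union_le hA hB hd Ω

theorem varMeasure_indicator_eq_zero_of_perimeter_eq_add (hA : MeasurableSet A)
    (hB : MeasurableSet B) (hd : Disjoint A B) (hP : perimeter (A ∪ B) < ⊤)
    (hadd : perimeter (A ∪ B) = perimeter A + perimeter B) :
    varMeasure (A.indicator fun _ => (1 : ℝ)) (densitySet (A ∪ B) 1) = 0 := by
  have hAB : perimeter A + perimeter B < ⊤ := hadd ▸ hP
  have hPA : variation (A.indicator fun _ => (1 : ℝ)) < ⊤ := le_self_add.trans_lt hAB
  have hPB : variation (B.indicator fun _ => (1 : ℝ)) < ⊤ := le_add_self.trans_lt hAB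
  change variation ((A ∪ B).indicator fun _ => (1 : ℝ)) < ⊤ at hP
  have hle := varM_union_le hA hB hd hP hPA hPB
  have hzero := varMeasure_indicator_densitySet_one (hA.union hB) hP
  have huniv : varM (locallyIntegrable_indicator_one (hA.union hB)) hP univ =
      (varM (locallyIntegrable_indicator_one hA) hPA +
        varM (locallyIntegrable_indicator_one hB) hPB) univ := by
    rw [Measure.add_apply, varM_open _ _ isOpen_univ, varM_open _ _ isOpen_univ,
      varM_open _ _ isOpen_univ]
    exact hadd
  refine le_antisymm ((varMeasure_le_varM (locallyIntegrable_indicator_one hA) hPA _).trans ?_)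
    bot_le
  rw [Measure.eq_of_le_of_measure_univ_eq hle huniv, Measure.add_apply] at hzero
  exact (add_eq_zero.1 hzero).1.le

theorem indecomposable_of_forall_ae_eq_const (hP : perimeter E < ⊤)
    (H : ∀ u : Ed d → ℝ, LocallyIntegrable u → variation u < ⊤ →
      varMeasure u (densitySet E 1) = 0 → ∃ c : ℝ, ∀ᵐ x ∂(volume.restrict E), u x = c) :
    Indecomposable E := by
  rintro ⟨A, B, hA, hB, rfl, hAB, hA0, hB0, hadd⟩
  have hd : Disjoint A B := disjoint_iff_inter_eq_empty.2 hAB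
  have hPA : perimeter A < ⊤ := le_self_add.trans_lt (hadd ▸ hP)
  obtain ⟨c, hc⟩ := H _ (locallyIntegrable_indicator_one hA) hPA
    (varMeasure_indicator_eq_zero_of_perimeter_eq_add hA hB hd hP hadd)
  rw [ae_restrict_iff' (hA.union hB)] at hc
  obtain ⟨x, hxA, hx⟩ : ∃ x ∈ A, A.indicator (fun _ => (1 : ℝ)) x = c := by
    by_contra! hcon
    refine hA0.ne' (measure_eq_zero_iff_ae_notMem.2 ?_)
    filter_upwards [hc] with x hx hxA using hcon x hxA (hx (.inl hxA))
  obtain ⟨y, hyB, hy⟩ : ∃ y ∈ B, A.indicator (fun _ => (1 : ℝ)) y = c := by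
    by_contra! hcon
    refine hB0.ne' (measure_eq_zero_iff_ae_notMem.2 ?_)
    filter_upwards [hc] with y hy hyB using hcon y hyB (hy (.inr hyB))
  rw [indicator_of_mem hxA] at hx
  rw [indicator_of_notMem fun h => hd.le_bot ⟨h, hyB⟩] at hy
  exact one_ne_zero (hx.trans hy.symm)

end Additivity

/-- **Dolzmann–Müller characterization of indecomposable sets**: `E` of finite perimeter is
indecomposable iff every `u ∈ BV_loc` with `V(u) < ∞` and `|Du|(E^1) = 0` is a.e. constant
on `E`. -/
theorem indecomposable_iff_bv_constant {d : ℕ} (E : Set (Ed d))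
    (hEm : MeasurableSet E) (hEper : perimeter E < ⊤) :
    Indecomposable E ↔
      ∀ u : Ed d → ℝ, LocallyIntegrable u volume → variation u < ⊤ →
        varMeasure u (densitySet E 1) = 0 →
        ∃ c : ℝ, ∀ᵐ x ∂(volume.restrict E), u x = c :=
  ⟨fun hI _ hu hV hz => hI.exists_ae_eq_const hEm hEper hu hV hz,
    indecomposable_of_forall_ae_eq_const hEper⟩
end
end

section
/- For every m ∈ ℕ, the map 𝔭 : Γ_m → M(ℝ^d;ℝ^d), γ ↦ μ_γ, is continuous when Γ_m := {γ ∈ Lip([0,1];ℝ^d) : |γ(0)| + ‖γ′‖_∞ ≤ m} carries the uniform (sup-norm) topology and M(ℝ^d;ℝ^d) carries the weak-star topology; that is, if γ_n → γ uniformly with γ_n, γ ∈ Γ_m, then ⟨μ_{γ_n}, Φ⟩ → ⟨μ_γ, Φ⟩ for every Φ ∈ C₀(ℝ^d;ℝ^d). -/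
open MeasureTheory Filter
open scoped ENNReal NNReal RealInnerProductSpace

noncomputable section

/-- Membership in `Γ_m = {γ ∈ Lip([0,1];ℝ^d) : |γ(0)| + ‖γ'‖_∞ ≤ m}` : `γ` is `K`-Lipschitz
(so `‖γ'‖_∞ ≤ K`) with `‖γ(0)‖ + K ≤ m`. -/
def memGammaM {d : ℕ} (γ : ℝ → Ed d) (m : ℕ) : Prop :=
  ∃ K : ℝ≥0, LipschitzWith K γ ∧ ‖γ 0‖ + (K : ℝ) ≤ (m : ℝ)

section LipschitzCurve

variable {E : Type*} [NormedAddCommGroup E] [InnerProductSpace ℝ E] [FiniteDimensional ℝ E]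
  {γ : ℝ → E} {K : ℝ≥0}

/-- Fundamental theorem of calculus for a Lipschitz curve, tested against a fixed vector. -/
theorem LipschitzWith.integral_inner_deriv_eq_sub (hγ : LipschitzWith K γ) (v : E) (a b : ℝ) :
    ∫ t in a..b, ⟪v, deriv γ t⟫ = ⟪v, γ b - γ a⟫ := by
  have hlip : LipschitzWith (‖innerSL ℝ v‖₊ * K) fun t => ⟪v, γ t⟫ :=
    (innerSL ℝ v).lipschitz.comp hγ
  have hftc := (hlip.lipschitzOnWith (s := Set.uIcc a b)).absolutelyContinuousOnInterval
    |>.integral_deriv_eq_sub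
  rw [inner_sub_right, ← hftc]
  refine intervalIntegral.integral_congr_ae ?_
  filter_upwards [hγ.ae_differentiableAt_real] with t ht _
  exact ((innerSL ℝ v).hasFDerivAt.comp_hasDerivAt t ht.hasDerivAt).deriv.symm

theorem LipschitzWith.intervalIntegrable_inner_deriv (hγ : LipschitzWith K γ) {F : ℝ → E}
    (hF : Continuous F) (a b : ℝ) :
    IntervalIntegrable (fun t => ⟪F t, deriv γ t⟫) volume a b := by
  refine IntervalIntegrable.mono_fun' (g := fun t => ‖F t‖ * K)
    (Continuous.intervalIntegrable (by fun_prop) a b)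
    (hF.aestronglyMeasurable.inner (aestronglyMeasurable_deriv γ _)) (.of_forall fun t => ?_)
  exact (norm_inner_le_norm _ _).trans
    (mul_le_mul_of_nonneg_left (norm_deriv_le_of_lipschitz hγ) (norm_nonneg _))

theorem LipschitzWith.abs_integral_inner_deriv_sub_le (hγ : LipschitzWith K γ) {F : ℝ → E}
    (hF : Continuous F) {a b ε : ℝ} (hε : ∀ t ∈ Set.uIoc a b, ‖F t - F a‖ ≤ ε) :
    |(∫ t in a..b, ⟪F t, deriv γ t⟫) - ⟪F a, γ b - γ a⟫| ≤ ε * K * |b - a| := by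
  rw [← hγ.integral_inner_deriv_eq_sub, ← intervalIntegral.integral_sub
    (hγ.intervalIntegrable_inner_deriv hF a b)
    (hγ.intervalIntegrable_inner_deriv continuous_const a b), ← Real.norm_eq_abs]
  refine intervalIntegral.norm_integral_le_of_norm_le_const fun t ht => ?_
  rw [← inner_sub_left]
  refine (norm_inner_le_norm _ _).trans ?_
  exact mul_le_mul (hε t ht) (norm_deriv_le_of_lipschitz hγ) (norm_nonneg _)
    ((norm_nonneg _).trans (hε t ht))

/-- The integral of a continuous field along a Lipschitz curve on `[0, 1]` is approximated by its
Riemann-Stieltjes sums over the uniform partition. -/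
theorem LipschitzWith.abs_integral_inner_deriv_sub_sum_le (hγ : LipschitzWith K γ) {F : ℝ → E}
    (hF : Continuous F) {N : ℕ} (hN : N ≠ 0) {ε : ℝ}
    (hε : ∀ s t : ℝ, |t - s| ≤ 1 / N → ‖F t - F s‖ ≤ ε) :
    |(∫ t in (0 : ℝ)..1, ⟪F t, deriv γ t⟫) -
      ∑ k ∈ Finset.range N, ⟪F (k / N), γ ((k + 1 : ℕ) / N) - γ (k / N)⟫| ≤ ε * K := by
  have hN' : (0 : ℝ) < N := by positivity
  have hsum := intervalIntegral.sum_integral_adjacent_intervals (μ := volume)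
    (f := fun t => ⟪F t, deriv γ t⟫) (a := fun k : ℕ => (k : ℝ) / N) (n := N)
    fun k _ => hγ.intervalIntegrable_inner_deriv hF _ _
  simp only [Nat.cast_zero, zero_div, div_self hN'.ne'] at hsum
  rw [← hsum, ← Finset.sum_sub_distrib]
  have hstep (k : ℕ) : |((k + 1 : ℕ) : ℝ) / N - k / N| = 1 / N := by
    rw [← sub_div, Nat.cast_succ, add_sub_cancel_left, abs_of_pos (by positivity)]
  calc
    _ ≤ ∑ _k ∈ Finset.range N, ε * K * (1 / N) := by
      refine (Finset.abs_sum_le_sum_abs _ _).trans (Finset.sum_le_sum fun k _ => ?_)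
      rw [← hstep k]
      refine hγ.abs_integral_inner_deriv_sub_le hF fun t ht => hε _ _ ?_
      rw [← hstep k]
      exact Set.abs_sub_left_of_mem_uIcc (Set.uIoc_subset_uIcc ht)
    _ = ε * K := by
      rw [Finset.sum_const, Finset.card_range, nsmul_eq_mul]
      field_simp

end LipschitzCurve

theorem memGammaM.lipschitzWith {d m : ℕ} {γ : ℝ → Ed d} (h : memGammaM γ m) :
    LipschitzWith m γ := by
  obtain ⟨K, hK, hle⟩ := h
  refine hK.weaken ?_
  rw [← NNReal.coe_le_coe, NNReal.coe_natCast]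
  linarith [norm_nonneg (γ 0)]

/-- **Continuity of `𝔭 : Γ_m → M(ℝ^d;ℝ^d)`, `γ ↦ μ_γ`**: if `γ_n → γ` uniformly on `[0,1]`
with `γ_n, γ ∈ Γ_m`, then `⟨μ_{γ_n}, Φ⟩ → ⟨μ_γ, Φ⟩` for every `Φ ∈ C₀(ℝ^d;ℝ^d)`. -/
theorem curve_measure_map_continuous {d : ℕ} (m : ℕ)
    (γn : ℕ → ℝ → Ed d) (γ : ℝ → Ed d)
    (hγn : ∀ n, memGammaM (γn n) m) (hγ : memGammaM γ m)
    (hconv : TendstoUniformlyOn (fun n t => γn n t) γ atTop (Set.Icc (0:ℝ) 1))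
    (Φ : Ed d → Ed d) (hΦc : Continuous Φ)
    (hΦ0 : Tendsto Φ (cocompact (Ed d)) (nhds 0)) :
    Tendsto (fun n => ∫ t in (0:ℝ)..1, ⟪Φ (γn n t), deriv (γn n) t⟫) atTop
      (nhds (∫ t in (0:ℝ)..1, ⟪Φ (γ t), deriv γ t⟫)) := by
  have hΦu : UniformContinuous Φ := hΦc.uniformContinuous_of_tendsto_cocompact hΦ0
  rw [Metric.tendsto_atTop]
  intro ε hε
  set η : ℝ := ε / (3 * (m + 1)) with hη
  have hηm : η * m < ε / 3 := by
    rw [hη, div_mul_eq_mul_div, div_lt_div_iff₀ (by positivity) (by positivity)]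
    nlinarith
  obtain ⟨δ, hδ, hδΦ⟩ := Metric.uniformContinuous_iff.1 hΦu η (by positivity)
  obtain ⟨n₀, hn₀⟩ := exists_nat_gt (m / δ)
  obtain ⟨N, hN⟩ : ∃ N, N = n₀ + 1 := ⟨_, rfl⟩
  have hN0 : 0 < N := by omega
  have hmN : m / (N : ℝ) < δ := by
    rw [div_lt_comm₀ (by positivity) hδ]
    exact hn₀.trans (by simp [hN])
  have happrox (c : ℝ → Ed d) (hc : memGammaM c m) :
      |(∫ t in (0 : ℝ)..1, ⟪Φ (c t), deriv c t⟫) -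
        ∑ k ∈ Finset.range N, ⟪Φ (c (k / N)), c ((k + 1 : ℕ) / N) - c (k / N)⟫| < ε / 3 := by
    have hlip := hc.lipschitzWith
    refine lt_of_le_of_lt (hlip.abs_integral_inner_deriv_sub_sum_le (hΦc.comp hlip.continuous)
      (N := N) hN0.ne' (ε := η) fun s t hst => ?_) (by simpa using hηm)
    rw [← dist_eq_norm]
    refine (hδΦ (lt_of_le_of_lt (hlip.dist_le_mul t s) (lt_of_le_of_lt ?_ hmN))).le
    rw [Real.dist_eq, NNReal.coe_natCast, div_eq_mul_one_div]
    gcongr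
  have hpt (k : ℕ) (hk : k ≤ N) : Tendsto (fun n => γn n (k / N)) atTop (nhds (γ (k / N))) :=
    hconv.tendsto_at ⟨by positivity, div_le_one_of_le₀ (by exact_mod_cast hk) (by positivity)⟩
  have hsum : Tendsto (fun n => ∑ k ∈ Finset.range N,
      ⟪Φ (γn n (k / N)), γn n ((k + 1 : ℕ) / N) - γn n (k / N)⟫) atTop
      (nhds (∑ k ∈ Finset.range N, ⟪Φ (γ (k / N)), γ ((k + 1 : ℕ) / N) - γ (k / N)⟫)) := by
    refine tendsto_finsetSum _ fun k hk => ?_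
    have hk' := Finset.mem_range.1 hk
    exact ((hΦc.tendsto _).comp (hpt k hk'.le)).inner ((hpt (k + 1) hk').sub (hpt k hk'.le))
  obtain ⟨M, hM⟩ := Metric.tendsto_atTop.1 hsum (ε / 3) (by positivity)
  refine ⟨M, fun n hn => ?_⟩
  have h₁ := abs_lt.1 (happrox _ (hγn n))
  have h₂ := abs_lt.1 (happrox _ hγ)
  have h₃ := hM n hn
  rw [Real.dist_eq, abs_lt] at h₃ ⊢
  constructor <;> linarith [h₁.1, h₁.2, h₂.1, h₂.2, h₃.1, h₃.2]
end
end
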